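/- (Coercivity of H² under orthogonality conditions.) There exists M₀ ≥ 1 such that for every M ≥ M₀ the quantity (H(χ_M Λφ), T₁) is nonzero, and, with Φ_M = χ_M Λφ − c_M·H(χ_M Λφ) where c_M = (χ_M Λφ, T₁)/(H(χ_M Λφ), T₁), there exists a constant C(M) > 0 with the following property: for every u ∈ C⁴((0,∞)) satisfying ∫ |(AHu)'|² + ∫ (AHu)²/(y²(1+y²)) + ∫ (Hu)²/(y⁴(1+|log y|)²) + ∫ u²/(y⁴(1+y⁴)(1+|log y|)²) + ∫ (u')²/(y²(1+y⁴)(1+|log y|)²) < ∞ and the orthogonality conditions (u, Φ_M) = 0 and (Hu, Φ_M) = 0, one has: ∫ (Hu)²/(y⁴(1+|log y|)²) + ∫ ((Hu)')²/(y²(1+|log y|)²) + ∫ (u'''')²/(1+|log y|)² + ∫ (u''')²/(y²(1+|log y|)²) + ∫ (u'')²/(y⁴(1+|log y|)²) + ∫ (u')²/(y²(1+y⁴)(1+|log y|)²) + ∫ u²/(y⁴(1+y⁴)(1+|log y|)²) ≤ C(M)·∫ (H²u)². -/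

import Mathlib

open MeasureTheory Real Set

noncomputable section

/-- `Z(y) = (1-y²)/(1+y²)`. -/
def Zfun (y : ℝ) : ℝ := (1 - y ^ 2) / (1 + y ^ 2)

/-- `Λφ(y) = 2y/(1+y²)`. -/
def Lphi (y : ℝ) : ℝ := 2 * y / (1 + y ^ 2)

/-- `V(y) = (y⁴-6y²+1)/(1+y²)²`. -/
def Vfun (y : ℝ) : ℝ := (y ^ 4 - 6 * y ^ 2 + 1) / (1 + y ^ 2) ^ 2

/-- `Au = -u' + (Z/y) u`. -/
def Aop (u : ℝ → ℝ) (y : ℝ) : ℝ := -(deriv u y) + Zfun y / y * u y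

/-- The linearized Hamiltonian `Hu = -u'' - u'/y + (V/y²) u`. -/
def Hop (u : ℝ → ℝ) (y : ℝ) : ℝ :=
  -(deriv (deriv u) y) - deriv u y / y + Vfun y / y ^ 2 * u y

/-- The profile `T₁` solving `H T₁ = Λφ`. -/
def T1 (y : ℝ) : ℝ :=
  -(((1 - y ^ 4) * Real.log (1 + y ^ 2) + 2 * y ^ 4 - y ^ 2
      - 4 * y ^ 2 * ∫ s in (0:ℝ)..y, Real.log (1 + s ^ 2) / s) / (2 * y * (1 + y ^ 2)))

/-- Inner product `(f,g) = ∫₀^∞ f g y dy`. -/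
def ip (f g : ℝ → ℝ) : ℝ := ∫ y in Set.Ioi (0:ℝ), f y * g y * y

/-- `χ_M Λφ` for a cutoff `χ`. -/
def cutLphi (χ : ℝ → ℝ) (M : ℝ) : ℝ → ℝ := fun y => χ (y / M) * Lphi y

/-- `c_M = (χ_M Λφ, T₁)/(H(χ_M Λφ), T₁)`. -/
def cMconst (χ : ℝ → ℝ) (M : ℝ) : ℝ :=
  ip (cutLphi χ M) T1 / ip (Hop (cutLphi χ M)) T1

/-- `Φ_M = χ_M Λφ − c_M H(χ_M Λφ)`. -/
def PhiM (χ : ℝ → ℝ) (M : ℝ) : ℝ → ℝ :=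
  fun y => cutLphi χ M y - cMconst χ M * Hop (cutLphi χ M) y

/-- A nonnegative function with uniformly bounded integrals over the compact subintervals of
`(0,∞)` is integrable there. -/
lemma integrableOn_Ioi_of_intervalIntegral_le {m : ℝ → ℝ} {B : ℝ}
    (hm : ContinuousOn m (Ioi 0)) (h0 : ∀ y, 0 < y → 0 ≤ m y)
    (hB : ∀ a b, 0 < a → a ≤ 1 → 1 ≤ b → ∫ y in a..b, m y ≤ B) :
    IntegrableOn m (Ioi 0) ∧ ∫ y in Ioi (0:ℝ), m y ≤ B := by
  have hcov : AECover (volume.restrict (Ioi (0:ℝ))) Filter.atTop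
      (fun n : ℕ => Ioc (1 / ((n:ℝ) + 1)) ((n:ℝ) + 1)) := by
    have h1 := aecover_Ioi_of_Ioi (μ := volume) (A := (0:ℝ))
      (a := fun n : ℕ => 1 / ((n:ℝ) + 1)) tendsto_one_div_add_atTop_nhds_zero_nat
    have h2 : AECover (volume.restrict (Ioi (0:ℝ))) Filter.atTop
        (fun n : ℕ => Iic ((n:ℝ) + 1)) :=
      aecover_Iic (Filter.tendsto_atTop_add_const_right _ _ tendsto_natCast_atTop_atTop)
    exact h1.inter h2
  have hpos : ∀ n : ℕ, (0:ℝ) < 1 / ((n:ℝ) + 1) := fun n => by positivity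
  have hle1 : ∀ n : ℕ, 1 / ((n:ℝ) + 1) ≤ 1 := fun n => by
    rw [div_le_one (by positivity)]; linarith [(Nat.cast_nonneg n : (0:ℝ) ≤ n)]
  have hge1 : ∀ n : ℕ, 1 ≤ (n:ℝ) + 1 := fun n => by
    linarith [(Nat.cast_nonneg n : (0:ℝ) ≤ n)]
  have hsub : ∀ n : ℕ, Ioc (1 / ((n:ℝ) + 1)) ((n:ℝ) + 1) ⊆ Ioi 0 := fun n y hy =>
    (hpos n).trans hy.1
  have h_integral : ∀ n : ℕ, IntegrableOn m (Ioc (1 / ((n:ℝ) + 1)) ((n:ℝ) + 1)) := fun n =>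
    ((hm.mono fun y hy => (hpos n).trans_le hy.1).integrableOn_Icc).mono_set Ioc_subset_Icc_self
  have hbd : ∀ n : ℕ, ∫ y in Ioc (1 / ((n:ℝ) + 1)) ((n:ℝ) + 1), m y ∂(volume.restrict (Ioi 0))
      ≤ B := fun n => by
    rw [Measure.restrict_restrict measurableSet_Ioc, inter_eq_left.2 (hsub n)]
    have := hB _ _ (hpos n) (hle1 n) (hge1 n)
    rwa [intervalIntegral.integral_of_le ((hle1 n).trans (hge1 n))] at this
  have hae : 0 ≤ᵐ[volume.restrict (Ioi (0:ℝ))] m :=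
    (ae_restrict_iff' measurableSet_Ioi).2 (Filter.Eventually.of_forall fun y hy => h0 y hy)
  have hI : IntegrableOn m (Ioi 0) := by
    refine hcov.integrable_of_integral_bounded_of_nonneg_ae B (fun n => ?_) hae
      (Filter.Eventually.of_forall hbd)
    rw [IntegrableOn, Measure.restrict_restrict measurableSet_Ioc, inter_eq_left.2 (hsub n)]
    exact h_integral n
  exact ⟨hI, le_of_tendsto (hcov.integral_tendsto_of_countably_generated hI)
    (Filter.Eventually.of_forall hbd)⟩

lemma intervalIntegral_le_integral_Ioi {k : ℝ → ℝ} (hk : IntegrableOn k (Ioi 0))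
    (h0 : ∀ y, 0 < y → 0 ≤ k y) {a b : ℝ} (ha : 0 < a) (hab : a ≤ b) :
    ∫ y in a..b, k y ≤ ∫ y in Ioi (0:ℝ), k y := by
  rw [intervalIntegral.integral_of_le hab]
  refine setIntegral_mono_set hk ?_ (Filter.Eventually.of_forall fun y hy => ha.trans hy.1)
  exact (ae_restrict_iff' measurableSet_Ioi).2 (Filter.Eventually.of_forall fun y hy => h0 y hy)

/-- Weighted Hardy inequality on an interval for an increasing weight. -/
lemma hardy_of_increasing {g h ρ ρ' m k : ℝ → ℝ} {a b : ℝ} (hab : a ≤ b)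
    (hg : ∀ y ∈ Icc a b, HasDerivAt g (h y) y) (hρ : ∀ y ∈ Icc a b, HasDerivAt ρ (ρ' y) y)
    (hpos : ∀ y ∈ Icc a b, 0 < ρ y) (hpos' : ∀ y ∈ Icc a b, 0 < ρ' y)
    (hm : IntegrableOn m (Icc a b)) (hk : IntegrableOn k (Icc a b))
    (hmg : ∀ y ∈ Icc a b, m y * ρ y ^ 2 ≤ g y ^ 2 * ρ' y)
    (hkh : ∀ y ∈ Icc a b, h y ^ 2 ≤ k y * ρ' y) :
    ∫ y in a..b, m y ≤ 2 * (g a ^ 2 / ρ a) + 4 * ∫ y in a..b, k y := by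
  have hder : ∀ y ∈ Icc a b, HasDerivAt (fun y => -2 * (g y ^ 2 / ρ y))
      (-2 * ((2 * g y * h y * ρ y - g y ^ 2 * ρ' y) / ρ y ^ 2)) y := fun y hy => by
    have := (((hg y hy).pow 2).div (hρ y hy) (hpos y hy).ne').const_mul (-2)
    simpa using this
  have key := intervalIntegral.integral_le_sub_of_hasDeriv_right_of_le hab
    (fun y hy => (hder y hy).continuousAt.continuousWithinAt)
    (fun y hy => (hder y (Ioo_subset_Icc_self hy)).hasDerivWithinAt) (hm.sub (hk.const_mul 4))
    (fun y hy => by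
      replace hy := Ioo_subset_Icc_self hy
      have h1 := hpos y hy
      have h2 := hpos' y hy
      have h3 := hmg y hy
      have h4 := hkh y hy
      simp only [Pi.sub_apply]
      rw [mul_div_assoc', le_div_iff₀ (by positivity)]
      have h5 : 0 ≤ ρ' y * (g y ^ 2 * ρ' y - 4 * g y * h y * ρ y + 4 * k y * ρ y ^ 2) := by
        have : 0 ≤ (k y * ρ' y - h y ^ 2) * ρ y ^ 2 := by
          apply mul_nonneg (by linarith) (by positivity)
        nlinarith [sq_nonneg (g y * ρ' y - 2 * h y * ρ y)]
      have h6 := nonneg_of_mul_nonneg_right h5 h2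
      nlinarith)
  have hm' : IntervalIntegrable m volume a b :=
    (intervalIntegrable_iff_integrableOn_Icc_of_le hab).2 hm
  have hk' : IntervalIntegrable k volume a b :=
    (intervalIntegrable_iff_integrableOn_Icc_of_le hab).2 hk
  simp only [Pi.sub_apply] at key
  rw [intervalIntegral.integral_sub hm' (hk'.const_mul 4),
    intervalIntegral.integral_const_mul] at key
  have : 0 ≤ g b ^ 2 / ρ b := div_nonneg (sq_nonneg _) (hpos b ⟨hab, le_rfl⟩).le
  linarith

/-- Weighted Hardy inequality on an interval for a decreasing weight. -/
lemma hardy_of_decreasing {g h ρ σ m k : ℝ → ℝ} {a b : ℝ} (hab : a ≤ b)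
    (hg : ∀ y ∈ Icc a b, HasDerivAt g (h y) y) (hρ : ∀ y ∈ Icc a b, HasDerivAt ρ (-σ y) y)
    (hpos : ∀ y ∈ Icc a b, 0 < ρ y) (hpos' : ∀ y ∈ Icc a b, 0 < σ y)
    (hm : IntegrableOn m (Icc a b)) (hk : IntegrableOn k (Icc a b))
    (hmg : ∀ y ∈ Icc a b, m y * ρ y ^ 2 ≤ g y ^ 2 * σ y)
    (hkh : ∀ y ∈ Icc a b, h y ^ 2 ≤ k y * σ y) :
    ∫ y in a..b, m y ≤ 2 * (g b ^ 2 / ρ b) + 4 * ∫ y in a..b, k y := by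
  have hder : ∀ y ∈ Icc a b, HasDerivAt (fun y => 2 * (g y ^ 2 / ρ y))
      (2 * ((2 * g y * h y * ρ y - g y ^ 2 * -σ y) / ρ y ^ 2)) y := fun y hy => by
    have := (((hg y hy).pow 2).div (hρ y hy) (hpos y hy).ne').const_mul 2
    simpa using this
  have key := intervalIntegral.integral_le_sub_of_hasDeriv_right_of_le hab
    (fun y hy => (hder y hy).continuousAt.continuousWithinAt)
    (fun y hy => (hder y (Ioo_subset_Icc_self hy)).hasDerivWithinAt) (hm.sub (hk.const_mul 4))
    (fun y hy => by
      replace hy := Ioo_subset_Icc_self hy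
      have h1 := hpos y hy
      have h2 := hpos' y hy
      have h3 := hmg y hy
      have h4 := hkh y hy
      simp only [Pi.sub_apply]
      rw [mul_div_assoc', le_div_iff₀ (by positivity)]
      have h5 : 0 ≤ σ y * (g y ^ 2 * σ y + 4 * g y * h y * ρ y + 4 * k y * ρ y ^ 2) := by
        have : 0 ≤ (k y * σ y - h y ^ 2) * ρ y ^ 2 := by
          apply mul_nonneg (by linarith) (by positivity)
        nlinarith [sq_nonneg (g y * σ y + 2 * h y * ρ y)]
      have h6 := nonneg_of_mul_nonneg_right h5 h2
      nlinarith)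
  have hm' : IntervalIntegrable m volume a b :=
    (intervalIntegrable_iff_integrableOn_Icc_of_le hab).2 hm
  have hk' : IntervalIntegrable k volume a b :=
    (intervalIntegrable_iff_integrableOn_Icc_of_le hab).2 hk
  simp only [Pi.sub_apply] at key
  rw [intervalIntegral.integral_sub hm' (hk'.const_mul 4),
    intervalIntegral.integral_const_mul] at key
  have : 0 ≤ g a ^ 2 / ρ a := div_nonneg (sq_nonneg _) (hpos a ⟨le_rfl, hab⟩).le
  linarith

/-- Weighted Hardy inequality on `(0,∞)` for functions vanishing at the origin (along a
sequence). -/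
lemma hardy_of_vanishing {g h ρ ρ' m k : ℝ → ℝ}
    (hg : ∀ y, 0 < y → HasDerivAt g (h y) y) (hρ : ∀ y, 0 < y → HasDerivAt ρ (ρ' y) y)
    (hpos : ∀ y, 0 < y → 0 < ρ y) (hpos' : ∀ y, 0 < y → 0 < ρ' y)
    (hlim : ∀ δ a : ℝ, 0 < δ → 0 < a → ∃ ε, 0 < ε ∧ ε < a ∧ g ε ^ 2 < δ)
    (hm : ContinuousOn m (Ioi 0)) (hm0 : ∀ y, 0 < y → 0 ≤ m y)
    (hk : IntegrableOn k (Ioi 0)) (hk0 : ∀ y, 0 < y → 0 ≤ k y)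
    (hmg : ∀ y, 0 < y → m y * ρ y ^ 2 ≤ g y ^ 2 * ρ' y)
    (hkh : ∀ y, 0 < y → h y ^ 2 ≤ k y * ρ' y) :
    IntegrableOn m (Ioi 0) ∧ ∫ y in Ioi (0:ℝ), m y ≤ 8 * ∫ y in Ioi (0:ℝ), k y := by
  have hsub : ∀ a b : ℝ, 0 < a → Icc a b ⊆ Ioi 0 := fun a b ha y hy => ha.trans_le hy.1
  have hbdry : ∀ a, 0 < a → g a ^ 2 ≤ 2 * ρ a * ∫ y in Ioi (0:ℝ), k y := by
    intro a ha
    refine le_of_forall_pos_le_add fun δ hδ => ?_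
    obtain ⟨ε, hε, hεa, hgε⟩ := hlim (δ / 2) a (by positivity) ha
    have hder : ∀ y ∈ Icc ε a, HasDerivAt (fun y => -(g y ^ 2 / (ρ y + ρ a)))
        (-((2 * g y * h y * (ρ y + ρ a) - g y ^ 2 * ρ' y) / (ρ y + ρ a) ^ 2)) y := by
      intro y hy
      have hy0 := hε.trans_le hy.1
      have := (((hg y hy0).pow 2).div ((hρ y hy0).add_const (ρ a))
        (add_pos (hpos y hy0) (hpos a ha)).ne').neg
      exact HasDerivAt.congr_deriv this (by simp)
    have key := intervalIntegral.integral_le_sub_of_hasDeriv_right_of_le hεa.le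
      (φ := fun y => -k y)
      (fun y hy => (hder y hy).continuousAt.continuousWithinAt)
      (fun y hy => (hder y (Ioo_subset_Icc_self hy)).hasDerivWithinAt)
      ((hk.mono_set (hsub ε a hε)).neg)
      (fun y hy => by
        have hy0 := hε.trans hy.1
        have h1 := hpos y hy0
        have h2 := hpos' y hy0
        have h4 := hkh y hy0
        have h3 := hpos a ha
        set r := ρ y + ρ a with hr
        have hr0 : 0 < r := by positivity
        rw [neg_le_neg_iff, div_le_iff₀ (by positivity)]
        have h5 : 0 ≤ ρ' y * (g y ^ 2 * ρ' y - 2 * g y * h y * r + k y * r ^ 2) := by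
          have : 0 ≤ (k y * ρ' y - h y ^ 2) * r ^ 2 := by
            apply mul_nonneg (by linarith) (by positivity)
          nlinarith [sq_nonneg (g y * ρ' y - h y * r)]
        have h6 := nonneg_of_mul_nonneg_right h5 h2
        linarith)
    rw [intervalIntegral.integral_neg] at key
    have hkI := intervalIntegral_le_integral_Ioi hk hk0 hε hεa.le
    have h1 := hpos a ha
    have h2 := hpos ε hε
    have h3 : g ε ^ 2 / (ρ ε + ρ a) ≤ (δ / 2) / ρ a :=
      div_le_div₀ (by positivity) hgε.le h1 (by linarith)
    have h4 : g a ^ 2 / (ρ a + ρ a) ≤ δ / 2 / ρ a + ∫ y in Ioi (0:ℝ), k y := by linarith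
    rw [div_le_iff₀ (by positivity)] at h4
    have h5 : (δ / 2 / ρ a + ∫ y in Ioi (0:ℝ), k y) * (ρ a + ρ a)
      = 2 * ρ a * (∫ y in Ioi (0:ℝ), k y) + δ := by field_simp; ring
    linarith
  refine integrableOn_Ioi_of_intervalIntegral_le hm hm0 fun a b ha ha1 hb1 => ?_
  have hab := ha1.trans hb1
  have hs := hsub a b ha
  have h1 := hardy_of_increasing hab (fun y hy => hg y (hs hy)) (fun y hy => hρ y (hs hy))
    (fun y hy => hpos y (hs hy)) (fun y hy => hpos' y (hs hy)) (hm.mono hs).integrableOn_Icc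
    (hk.mono_set hs) (fun y hy => hmg y (hs hy)) (fun y hy => hkh y (hs hy))
  have h2 := intervalIntegral_le_integral_Ioi hk hk0 ha hab
  have h3 : g a ^ 2 / ρ a ≤ 2 * ∫ y in Ioi (0:ℝ), k y := by
    rw [div_le_iff₀ (hpos a ha)]; linarith [hbdry a ha]
  linarith

lemma one_add_sq_log_le (y : ℝ) : 1 + Real.log y ^ 2 ≤ (1 + |Real.log y|) ^ 2 := by
  nlinarith [abs_nonneg (Real.log y), sq_abs (Real.log y)]

lemma sq_one_add_abs_log_le (y : ℝ) : (1 + |Real.log y|) ^ 2 ≤ 2 * (1 + Real.log y ^ 2) := by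
  nlinarith [sq_nonneg (1 - |Real.log y|), sq_abs (Real.log y)]

lemma one_le_one_add_abs_log (y : ℝ) : 1 ≤ 1 + |Real.log y| := by
  linarith [abs_nonneg (Real.log y)]

lemma mul_one_add_abs_log_le_one {y : ℝ} (hy : 0 < y) (hy1 : y ≤ 1) :
    y * (1 + |Real.log y|) ≤ 1 := by
  rw [abs_of_nonpos (Real.log_nonpos hy.le hy1)]
  have h := Real.one_sub_inv_le_log_of_pos hy
  have h2 : y * (1 - y⁻¹) ≤ y * Real.log y := mul_le_mul_of_nonneg_left h hy.le
  have h3 : y * (1 - y⁻¹) = y - 1 := by field_simp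
  linarith

lemma one_add_log_one_add_sq_le {y : ℝ} (hy : 0 < y) :
    1 + Real.log (1 + y ^ 2) ≤ 2 * (1 + |Real.log y|) := by
  have hlog2 : Real.log 2 ≤ 1 := by linarith [Real.log_two_lt_d9]
  rcases le_total y 1 with h | h
  · have : Real.log (1 + y ^ 2) ≤ Real.log 2 :=
      Real.log_le_log (by positivity) (by nlinarith)
    linarith [abs_nonneg (Real.log y)]
  · have : Real.log (1 + y ^ 2) ≤ Real.log (2 * y ^ 2) :=
      Real.log_le_log (by positivity) (by nlinarith)
    rw [Real.log_mul (by norm_num) (by positivity), Real.log_pow] at this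
    push_cast at this
    linarith [le_abs_self (Real.log y)]

lemma one_le_one_add_log_one_add_sq (y : ℝ) : 1 ≤ 1 + Real.log (1 + y ^ 2) := by
  linarith [Real.log_nonneg (by nlinarith [sq_nonneg y] : (1:ℝ) ≤ 1 + y ^ 2)]

lemma continuousOn_one_add_abs_log : ContinuousOn (fun y => 1 + |Real.log y|) (Ioi 0) :=
  continuousOn_const.add ((Real.continuousOn_log.mono fun _ hy => ne_of_gt hy).abs)

/-- Derivative of the quotient of `u` by the resonance, when `Au = q`. -/
lemma hasDerivAt_mul_one_add_sq_div {u q : ℝ → ℝ} {y : ℝ} (hy : 0 < y)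
    (hu : HasDerivAt u (-q y + Zfun y / y * u y) y) :
    HasDerivAt (fun y => u y * ((1 + y ^ 2) / y)) (-q y * ((1 + y ^ 2) / y)) y := by
  have h1 : HasDerivAt (fun y : ℝ => (1 + y ^ 2) / y) ((2 * y * y - (1 + y ^ 2)) / y ^ 2) y := by
    have := (((hasDerivAt_id y).pow 2).const_add 1).div (hasDerivAt_id y) hy.ne'
    exact HasDerivAt.congr_deriv this (by simp)
  refine HasDerivAt.congr_deriv (hu.mul h1) ?_
  unfold Zfun
  have : 1 + y ^ 2 ≠ 0 := by positivity
  field_simp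
  ring

lemma hasDerivAt_one_add_sq_log {y : ℝ} (hy : 0 < y) :
    HasDerivAt (fun y => 1 + Real.log y ^ 2) (2 * Real.log y / y) y := by
  have := ((Real.hasDerivAt_log hy.ne').pow 2).const_add 1
  exact HasDerivAt.congr_deriv this (by simp; ring)

/-- Inversion of `A` on `[1,∞)` and `(0,1]`: a logarithmic Hardy inequality, with the value at `1`
as the only boundary contribution. -/
lemma hardy_Aop (n : ℕ) {u q m k : ℝ → ℝ}
    (hu : ∀ y, 0 < y → HasDerivAt u (-q y + Zfun y / y * u y) y)
    (hm : ContinuousOn m (Ioi 0)) (hm0 : ∀ y, 0 < y → 0 ≤ m y)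
    (hk : IntegrableOn k (Ioi 0)) (hk0 : ∀ y, 0 < y → 0 ≤ k y)
    (hmn : ∀ y, 0 < y → y ≤ 1 → m y * (y ^ 3 * (1 + |Real.log y|) ^ 2) ≤ u y ^ 2)
    (hmf : ∀ y, 1 ≤ y → m y * (y ^ (n + 3) * (1 + |Real.log y|) ^ 2) ≤ u y ^ 2)
    (hkn : ∀ y, 0 < y → y ≤ 1 → 4 * q y ^ 2 ≤ k y * y)
    (hkf : ∀ y, 1 ≤ y → 4 * q y ^ 2 ≤ k y * (y ^ (n + 1) * (1 + |Real.log y|) ^ 2)) :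
    IntegrableOn m (Ioi 0) ∧
      ∫ y in Ioi (0:ℝ), m y ≤ 16 * u 1 ^ 2 + 4 * ∫ y in Ioi (0:ℝ), k y := by
  have hsub : ∀ a b : ℝ, 0 < a → Icc a b ⊆ Ioi 0 := fun a b ha y hy => ha.trans_le hy.1
  refine integrableOn_Ioi_of_intervalIntegral_le hm hm0 fun a b ha ha1 hb1 => ?_
  have hmI : ∀ a b : ℝ, 0 < a → IntegrableOn m (Icc a b) := fun a b ha =>
    (hm.mono (hsub a b ha)).integrableOn_Icc
  have hkI : ∀ a b : ℝ, 0 < a → IntegrableOn k (Icc a b) := fun a b ha =>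
    hk.mono_set (hsub a b ha)
  have hnear := hardy_of_decreasing (g := fun y => u y * ((1 + y ^ 2) / y))
    (h := fun y => -q y * ((1 + y ^ 2) / y)) (ρ := fun y => 1 - Real.log y) (σ := fun y => 1 / y)
    (m := m) (k := k) ha1
    (fun y hy => hasDerivAt_mul_one_add_sq_div (ha.trans_le hy.1) (hu y (ha.trans_le hy.1)))
    (fun y hy => by
      have := (Real.hasDerivAt_log (ha.trans_le hy.1).ne').const_sub 1
      exact HasDerivAt.congr_deriv this (by simp))
    (fun y hy => by linarith [Real.log_nonpos (ha.trans_le hy.1).le hy.2])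
    (fun y hy => by have := ha.trans_le hy.1; positivity)
    (hmI _ _ ha) (hkI _ _ ha)
    (fun y hy => by
      have hy0 := ha.trans_le hy.1
      have h1 := hmn y hy0 hy.2
      rw [abs_of_nonpos (Real.log_nonpos hy0.le hy.2), ← sub_eq_add_neg] at h1
      have h2 : (u y * ((1 + y ^ 2) / y)) ^ 2 * (1 / y) = u y ^ 2 * (1 + y ^ 2) ^ 2 / y ^ 3 := by
        field_simp
      rw [h2, le_div_iff₀ (by positivity)]
      have h3 : u y ^ 2 * 1 ≤ u y ^ 2 * (1 + y ^ 2) ^ 2 :=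
        mul_le_mul_of_nonneg_left (by nlinarith [sq_nonneg y]) (sq_nonneg _)
      nlinarith)
    (fun y hy => by
      have hy0 := ha.trans_le hy.1
      have h1 := hkn y hy0 hy.2
      have h2 : (-q y * ((1 + y ^ 2) / y)) ^ 2 = q y ^ 2 * (1 + y ^ 2) ^ 2 / y ^ 2 := by
        field_simp
      rw [h2, div_le_iff₀ (by positivity)]
      have h5 : y ^ 2 ≤ 1 := pow_le_one₀ hy0.le hy.2
      have h3 : q y ^ 2 * (1 + y ^ 2) ^ 2 ≤ q y ^ 2 * 4 :=
        mul_le_mul_of_nonneg_left (by nlinarith [sq_nonneg y]) (sq_nonneg _)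
      have h4 : k y * (1 / y) * y ^ 2 = k y * y := by field_simp
      rw [h4]; linarith)
  have hfar := hardy_of_increasing (g := fun y => u y * ((1 + y ^ 2) / y))
    (h := fun y => -q y * ((1 + y ^ 2) / y))
    (ρ := fun y => y ^ (n + 4) * (1 + Real.log y ^ 2))
    (ρ' := fun y => ((n + 4 : ℕ) : ℝ) * y ^ (n + 3) * (1 + Real.log y ^ 2)
      + y ^ (n + 4) * (2 * Real.log y / y)) (m := m) (k := k) hb1
    (fun y hy => hasDerivAt_mul_one_add_sq_div (one_pos.trans_le hy.1)
      (hu y (one_pos.trans_le hy.1)))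
    (fun y hy => (hasDerivAt_pow (n + 4) y).mul (hasDerivAt_one_add_sq_log (one_pos.trans_le hy.1)))
    (fun y hy => by have := one_pos.trans_le hy.1; positivity)
    (fun y hy => by
      have := one_pos.trans_le hy.1
      have := Real.log_nonneg hy.1
      positivity)
    (hmI _ _ one_pos) (hkI _ _ one_pos)
    (fun y hy => by
      have hy0 := one_pos.trans_le hy.1
      have hl := Real.log_nonneg hy.1
      have h1 := hmf y hy.1
      have h2 := one_add_sq_log_le y
      have h3 : m y * (y ^ (n + 3) * (1 + Real.log y ^ 2)) ≤ u y ^ 2 :=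
        le_trans (mul_le_mul_of_nonneg_left (mul_le_mul_of_nonneg_left h2 (by positivity))
          (hm0 y hy0)) h1
      have h4 : y ^ (n + 3) * (1 + Real.log y ^ 2) ≤ ((n + 4 : ℕ) : ℝ) * y ^ (n + 3)
          * (1 + Real.log y ^ 2) + y ^ (n + 4) * (2 * Real.log y / y) := by
        have : 0 ≤ y ^ (n + 4) * (2 * Real.log y / y) := by positivity
        have : (0:ℝ) ≤ (n + 3) * (y ^ (n + 3) * (1 + Real.log y ^ 2)) := by positivity
        push_cast
        linarith
      have h5 : u y ^ 2 * y ^ 2 ≤ (u y * ((1 + y ^ 2) / y)) ^ 2 := by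
        have : (u y * ((1 + y ^ 2) / y)) ^ 2 = u y ^ 2 * ((1 + y ^ 2) / y) ^ 2 := by ring
        rw [this]
        refine mul_le_mul_of_nonneg_left (pow_le_pow_left₀ hy0.le ?_ 2) (sq_nonneg _)
        rw [le_div_iff₀ hy0]; nlinarith
      calc m y * (y ^ (n + 4) * (1 + Real.log y ^ 2)) ^ 2
          = (m y * (y ^ (n + 3) * (1 + Real.log y ^ 2))) * y ^ 2
              * (y ^ (n + 3) * (1 + Real.log y ^ 2)) := by ring
        _ ≤ u y ^ 2 * y ^ 2 * (y ^ (n + 3) * (1 + Real.log y ^ 2)) := by gcongr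
        _ ≤ _ := by gcongr)
    (fun y hy => by
      have hy0 := one_pos.trans_le hy.1
      have hl := Real.log_nonneg hy.1
      have h1 := hkf y hy.1
      have h2 := sq_one_add_abs_log_le y
      have hk0y := hk0 y hy0
      have h4 : 2 * (y ^ (n + 3) * (1 + Real.log y ^ 2)) ≤ ((n + 4 : ℕ) : ℝ) * y ^ (n + 3)
          * (1 + Real.log y ^ 2) + y ^ (n + 4) * (2 * Real.log y / y) := by
        have : 0 ≤ y ^ (n + 4) * (2 * Real.log y / y) := by positivity
        have : (0:ℝ) ≤ (n + 2) * (y ^ (n + 3) * (1 + Real.log y ^ 2)) := by positivity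
        push_cast
        linarith
      have h5 : (-q y * ((1 + y ^ 2) / y)) ^ 2 ≤ 4 * q y ^ 2 * y ^ 2 := by
        have : (-q y * ((1 + y ^ 2) / y)) ^ 2 = q y ^ 2 * ((1 + y ^ 2) / y) ^ 2 := by ring
        rw [this]
        have h6 : ((1 + y ^ 2) / y) ^ 2 ≤ (2 * y) ^ 2 := by
          refine pow_le_pow_left₀ (by positivity) ?_ 2
          rw [div_le_iff₀ hy0]; nlinarith [hy.1]
        nlinarith [sq_nonneg (q y)]
      calc _ ≤ 4 * q y ^ 2 * y ^ 2 := h5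
        _ ≤ k y * (y ^ (n + 1) * (1 + |Real.log y|) ^ 2) * y ^ 2 := by gcongr
        _ ≤ k y * (y ^ (n + 1) * (2 * (1 + Real.log y ^ 2))) * y ^ 2 := by gcongr
        _ = k y * (2 * (y ^ (n + 3) * (1 + Real.log y ^ 2))) := by ring
        _ ≤ _ := by gcongr)
  have hsplit : ∫ y in a..b, m y = (∫ y in a..1, m y) + ∫ y in (1:ℝ)..b, m y :=
    (intervalIntegral.integral_add_adjacent_intervals
      ((intervalIntegrable_iff_integrableOn_Icc_of_le ha1).2 (hmI _ _ ha))
      ((intervalIntegrable_iff_integrableOn_Icc_of_le hb1).2 (hmI _ _ one_pos))).symm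
  have ksplit : ∫ y in a..b, k y = (∫ y in a..1, k y) + ∫ y in (1:ℝ)..b, k y :=
    (intervalIntegral.integral_add_adjacent_intervals
      ((intervalIntegrable_iff_integrableOn_Icc_of_le ha1).2 (hkI _ _ ha))
      ((intervalIntegrable_iff_integrableOn_Icc_of_le hb1).2 (hkI _ _ one_pos))).symm
  have hkb := intervalIntegral_le_integral_Ioi hk hk0 ha (ha1.trans hb1)
  norm_num at hnear hfar
  rw [hsplit]
  nlinarith

/-- A function `g` with `g² / y` integrable near the origin is small along a sequence. -/
lemma exists_sq_lt_of_integrableOn {g j : ℝ → ℝ} (hj : IntegrableOn j (Ioi 0))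
    (hgj : ∀ y, 0 < y → y ≤ 1 → g y ^ 2 ≤ j y * y) {δ a : ℝ} (hδ : 0 < δ) (ha : 0 < a) :
    ∃ ε, 0 < ε ∧ ε < a ∧ g ε ^ 2 < δ := by
  by_contra! hcon
  set c := min (a / 2) 1 with hc
  have hc0 : 0 < c := by positivity
  have hca : c < a := (min_le_left _ _).trans_lt (by linarith)
  have h1 : IntegrableOn (fun y : ℝ => δ * y⁻¹) (Ioc 0 c) := by
    refine Integrable.mono' (hj.mono_set fun y hy => hy.1)
      (measurable_inv.const_mul δ).aestronglyMeasurable ?_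
    refine (ae_restrict_iff' measurableSet_Ioc).2 (Filter.Eventually.of_forall fun y hy => ?_)
    have hy0 := hy.1
    have h2 := hcon y hy0 (hy.2.trans_lt hca)
    have h3 := hgj y hy0 (hy.2.trans (min_le_right _ _))
    rw [Real.norm_of_nonneg (by positivity), ← div_eq_mul_inv, div_le_iff₀ hy0]
    linarith
  have h2 : IntervalIntegrable (fun y : ℝ => y⁻¹) volume 0 c := by
    rw [intervalIntegrable_iff_integrableOn_Ioc_of_le hc0.le]
    simpa [hδ.ne', IntegrableOn] using h1.const_mul δ⁻¹
  rw [intervalIntegrable_inv_iff] at h2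
  rcases h2 with h2 | h2
  · exact hc0.ne h2
  · exact h2 left_mem_uIcc

lemma hasDerivAt_mul_sq_div {w f : ℝ → ℝ} {y : ℝ} (hy : 0 < y)
    (hw : HasDerivAt w (f y - 2 / (y * (1 + y ^ 2)) * w y) y) :
    HasDerivAt (fun y => w y * (y ^ 2 / (1 + y ^ 2))) (f y * (y ^ 2 / (1 + y ^ 2))) y := by
  have h0 : 1 + y ^ 2 ≠ 0 := by positivity
  have h1 : HasDerivAt (fun y : ℝ => y ^ 2 / (1 + y ^ 2))
      ((2 * y * (1 + y ^ 2) - y ^ 2 * (2 * y)) / (1 + y ^ 2) ^ 2) y := by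
    have := ((hasDerivAt_id y).pow 2).div (((hasDerivAt_id y).pow 2).const_add 1) h0
    exact HasDerivAt.congr_deriv this (by simp)
  refine HasDerivAt.congr_deriv (hw.mul h1) ?_
  field_simp
  ring

/-- Inversion of the adjoint `A*` on `L²`. -/
lemma hardy_adjoint_L2 {w f : ℝ → ℝ}
    (hw : ∀ y, 0 < y → HasDerivAt w (f y - 2 / (y * (1 + y ^ 2)) * w y) y)
    (hwI : IntegrableOn (fun y => w y ^ 2 / (y ^ 2 * (1 + y ^ 2)) * y) (Ioi 0))
    (hf : IntegrableOn (fun y => f y ^ 2 * y) (Ioi 0)) :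
    IntegrableOn (fun y => w y ^ 2 / (y * (1 + Real.log (1 + y ^ 2)) ^ 2)) (Ioi 0) ∧
      ∫ y in Ioi (0:ℝ), w y ^ 2 / (y * (1 + Real.log (1 + y ^ 2)) ^ 2)
        ≤ 8 * ∫ y in Ioi (0:ℝ), f y ^ 2 * y := by
  have hwc : ContinuousOn w (Ioi 0) := fun y hy => (hw y hy).continuousAt.continuousWithinAt
  have hℓ : ∀ y : ℝ, 1 ≤ 1 + Real.log (1 + y ^ 2) := one_le_one_add_log_one_add_sq
  have hρ'le : ∀ y : ℝ, 0 < y → 2 * y ^ 3 / (1 + y ^ 2) ^ 2 ≤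
      4 * y ^ 3 / (1 + y ^ 2) ^ 3 * (1 + Real.log (1 + y ^ 2))
      + y ^ 4 / (1 + y ^ 2) ^ 2 * (2 * y / (1 + y ^ 2)) := fun y hy => by
    have h1 : 4 * y ^ 3 / (1 + y ^ 2) ^ 3 * 1 ≤
      4 * y ^ 3 / (1 + y ^ 2) ^ 3 * (1 + Real.log (1 + y ^ 2)) :=
        mul_le_mul_of_nonneg_left (hℓ y) (by positivity)
    have h2 : 4 * y ^ 3 / (1 + y ^ 2) ^ 3 * 1 + y ^ 4 / (1 + y ^ 2) ^ 2 * (2 * y / (1 + y ^ 2))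
      = 2 * y ^ 3 / (1 + y ^ 2) ^ 2 + 2 * y ^ 3 / (1 + y ^ 2) ^ 3 := by
        field_simp; ring
    have h3 : 0 < 2 * y ^ 3 / (1 + y ^ 2) ^ 3 := by positivity
    linarith
  refine hardy_of_vanishing (g := fun y => w y * (y ^ 2 / (1 + y ^ 2)))
    (h := fun y => f y * (y ^ 2 / (1 + y ^ 2)))
    (ρ := fun y => y ^ 4 / (1 + y ^ 2) ^ 2 * (1 + Real.log (1 + y ^ 2)))
    (ρ' := fun y => 4 * y ^ 3 / (1 + y ^ 2) ^ 3 * (1 + Real.log (1 + y ^ 2))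
      + y ^ 4 / (1 + y ^ 2) ^ 2 * (2 * y / (1 + y ^ 2)))
    (fun y hy => hasDerivAt_mul_sq_div hy (hw y hy)) (fun y hy => ?_)
    (fun y hy => ?_) (fun y hy => ?_) (fun δ a hδ ha => ?_) ?_ (fun y hy => ?_) hf
    (fun y hy => by positivity) (fun y hy => ?_) (fun y hy => ?_)
  · have h0 : 1 + y ^ 2 ≠ 0 := by positivity
    have h1 : HasDerivAt (fun y : ℝ => 1 + y ^ 2) (2 * y) y := by
      simpa using ((hasDerivAt_id y).pow 2).const_add 1
    have h2 := (((hasDerivAt_pow 4 y).div (h1.pow 2) (pow_ne_zero 2 h0)).mul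
      ((h1.log h0).const_add 1))
    refine HasDerivAt.congr_deriv h2 ?_
    simp only [Pi.div_apply, Pi.pow_apply]
    congr 1
    congr 1
    push_cast
    field_simp
    ring
  · have := zero_lt_one.trans_le (hℓ y); positivity
  · exact lt_of_lt_of_le (by positivity) (hρ'le y hy)
  · refine exists_sq_lt_of_integrableOn hwI (fun y hy hy1 => ?_) hδ ha
    have h1 : (w y * (y ^ 2 / (1 + y ^ 2))) ^ 2 = w y ^ 2 / (1 + y ^ 2) * (y ^ 4 / (1 + y ^ 2)) := by
      field_simp
    have h2 : w y ^ 2 / (y ^ 2 * (1 + y ^ 2)) * y * y = w y ^ 2 / (1 + y ^ 2) * 1 := by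
      field_simp
    rw [h1, h2]
    refine mul_le_mul_of_nonneg_left ?_ (by positivity)
    rw [div_le_one (by positivity)]
    have : y ^ 4 ≤ 1 := pow_le_one₀ hy.le hy1
    nlinarith
  · refine (hwc.pow 2).div ?_ fun y hy => ?_
    · refine continuousOn_id.mul (ContinuousOn.pow (continuousOn_const.add
        (ContinuousOn.log (by fun_prop) fun y _ => by positivity)) 2)
    · have := zero_lt_one.trans_le (hℓ y)
      have : 0 < y := hy
      positivity
  · positivity
  · have := zero_lt_one.trans_le (hℓ y)
    refine le_trans (le_of_eq ?_) (mul_le_mul_of_nonneg_left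
      (le_trans ?_ (hρ'le y hy)) (sq_nonneg _) (b := y ^ 3 / (1 + y ^ 2) ^ 2))
    · field_simp
    · gcongr; linarith [pow_pos hy 3]
  · refine le_trans (le_of_eq ?_) (mul_le_mul_of_nonneg_left
      (le_trans ?_ (hρ'le y hy)) (by positivity) (b := y ^ 3 / (1 + y ^ 2) ^ 2))
    · field_simp
    · gcongr; linarith [pow_pos hy 3]

/-- Inversion of the adjoint `A*` in the logarithmically weighted space. -/
lemma hardy_adjoint_log {q v : ℝ → ℝ}
    (hq : ∀ y, 0 < y → HasDerivAt q (v y - 2 / (y * (1 + y ^ 2)) * q y) y)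
    (hlim : ∀ δ a : ℝ, 0 < δ → 0 < a →
      ∃ ε, 0 < ε ∧ ε < a ∧ (q ε * (ε ^ 2 / (1 + ε ^ 2))) ^ 2 < δ)
    (hv : IntegrableOn (fun y => v y ^ 2 * (1 / (y ^ 4 * (1 + |Real.log y|) ^ 2) * y)) (Ioi 0)) :
    IntegrableOn (fun y => q y ^ 2 * (1 / (y ^ 6 * (1 + |Real.log y|) ^ 2) * y)) (Ioi 0) ∧
      ∫ y in Ioi (0:ℝ), q y ^ 2 * (1 / (y ^ 6 * (1 + |Real.log y|) ^ 2) * y)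
        ≤ 8 * ∫ y in Ioi (0:ℝ), v y ^ 2 * (1 / (y ^ 4 * (1 + |Real.log y|) ^ 2) * y) := by
  have hqc : ContinuousOn q (Ioi 0) := fun y hy => (hq y hy).continuousAt.continuousWithinAt
  have hL : ∀ y : ℝ, 1 ≤ 1 + |Real.log y| := one_le_one_add_abs_log
  have hρ'le : ∀ y : ℝ, 0 < y → 3 * y ^ 7 / (1 + y ^ 2) ^ 2 * (1 + Real.log y ^ 2) ≤
      (8 * y ^ 7 + 4 * y ^ 9) / (1 + y ^ 2) ^ 3 * (1 + Real.log y ^ 2)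
      + y ^ 8 / (1 + y ^ 2) ^ 2 * (2 * Real.log y / y) := fun y hy => by
    have h1 : (8 * y ^ 7 + 4 * y ^ 9) / (1 + y ^ 2) ^ 3 * (1 + Real.log y ^ 2)
      + y ^ 8 / (1 + y ^ 2) ^ 2 * (2 * Real.log y / y)
      = 3 * y ^ 7 / (1 + y ^ 2) ^ 2 * (1 + Real.log y ^ 2)
        + y ^ 7 / (1 + y ^ 2) ^ 2 * (1 + Real.log y) ^ 2
        + 4 * y ^ 7 / (1 + y ^ 2) ^ 3 * (1 + Real.log y ^ 2) := by
      field_simp; ring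
    have h2 : 0 ≤ y ^ 7 / (1 + y ^ 2) ^ 2 * (1 + Real.log y) ^ 2 := by positivity
    have h3 : 0 ≤ 4 * y ^ 7 / (1 + y ^ 2) ^ 3 * (1 + Real.log y ^ 2) := by positivity
    linarith
  refine hardy_of_vanishing (g := fun y => q y * (y ^ 2 / (1 + y ^ 2)))
    (h := fun y => v y * (y ^ 2 / (1 + y ^ 2)))
    (ρ := fun y => y ^ 8 / (1 + y ^ 2) ^ 2 * (1 + Real.log y ^ 2))
    (ρ' := fun y => (8 * y ^ 7 + 4 * y ^ 9) / (1 + y ^ 2) ^ 3 * (1 + Real.log y ^ 2)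
      + y ^ 8 / (1 + y ^ 2) ^ 2 * (2 * Real.log y / y))
    (fun y hy => hasDerivAt_mul_sq_div hy (hq y hy)) (fun y hy => ?_)
    (fun y hy => ?_) (fun y hy => ?_) hlim ?_ (fun y hy => ?_) hv
    (fun y hy => by positivity) (fun y hy => ?_) (fun y hy => ?_)
  · have h0 : 1 + y ^ 2 ≠ 0 := by positivity
    have h1 : HasDerivAt (fun y : ℝ => 1 + y ^ 2) (2 * y) y := by
      simpa using ((hasDerivAt_id y).pow 2).const_add 1
    have h2 := (((hasDerivAt_pow 8 y).div (h1.pow 2) (pow_ne_zero 2 h0)).mul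
      (hasDerivAt_one_add_sq_log hy))
    refine HasDerivAt.congr_deriv h2 ?_
    simp only [Pi.div_apply, Pi.pow_apply]
    congr 1
    congr 1
    push_cast
    field_simp
    ring
  · positivity
  · exact lt_of_lt_of_le (by positivity) (hρ'le y hy)
  · refine (hqc.pow 2).mul (ContinuousOn.mul (continuousOn_const.div
      ((continuousOn_id.pow 6).mul (continuousOn_one_add_abs_log.pow 2)) fun y hy => ?_)
      continuousOn_id)
    have := zero_lt_one.trans_le (hL y)
    have : 0 < y := hy
    positivity
  · positivity
  · have h0 := zero_lt_one.trans_le (hL y)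
    have h1 := one_add_sq_log_le y
    refine le_trans ?_ (mul_le_mul_of_nonneg_left (hρ'le y hy) (sq_nonneg _))
    have e1 : q y ^ 2 * (1 / (y ^ 6 * (1 + |Real.log y|) ^ 2) * y)
        * (y ^ 8 / (1 + y ^ 2) ^ 2 * (1 + Real.log y ^ 2)) ^ 2
        = q y ^ 2 * y ^ 11 / (1 + y ^ 2) ^ 4 * (1 + Real.log y ^ 2)
          * ((1 + Real.log y ^ 2) / (1 + |Real.log y|) ^ 2) := by
      field_simp
    have e2 : (q y * (y ^ 2 / (1 + y ^ 2))) ^ 2 * (3 * y ^ 7 / (1 + y ^ 2) ^ 2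
        * (1 + Real.log y ^ 2))
        = q y ^ 2 * y ^ 11 / (1 + y ^ 2) ^ 4 * (1 + Real.log y ^ 2) * 3 := by
      field_simp
    rw [e1, e2]
    refine mul_le_mul_of_nonneg_left ?_ (by positivity)
    rw [div_le_iff₀ (by positivity)]
    nlinarith
  · have h0 := zero_lt_one.trans_le (hL y)
    have h1 := sq_one_add_abs_log_le y
    refine le_trans ?_ (mul_le_mul_of_nonneg_left (hρ'le y hy) (by positivity))
    have e1 : (v y * (y ^ 2 / (1 + y ^ 2))) ^ 2 = v y ^ 2 * y ^ 4 / (1 + y ^ 2) ^ 2 * 1 := by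
      field_simp
    have e2 : v y ^ 2 * (1 / (y ^ 4 * (1 + |Real.log y|) ^ 2) * y) *
        (3 * y ^ 7 / (1 + y ^ 2) ^ 2 * (1 + Real.log y ^ 2))
        = v y ^ 2 * y ^ 4 / (1 + y ^ 2) ^ 2
          * (3 * (1 + Real.log y ^ 2) / (1 + |Real.log y|) ^ 2) := by
      field_simp
    rw [e1, e2]
    refine mul_le_mul_of_nonneg_left ?_ (by positivity)
    rw [le_div_iff₀ (by positivity)]
    nlinarith [sq_nonneg (Real.log y)]

lemma hasDerivAt_Lphi (y : ℝ) : HasDerivAt Lphi (2 * (1 - y ^ 2) / (1 + y ^ 2) ^ 2) y := by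
  have h0 : 1 + y ^ 2 ≠ 0 := by positivity
  have h2 := ((hasDerivAt_id y).const_mul 2).div (((hasDerivAt_id y).pow 2).const_add 1) h0
  refine HasDerivAt.congr_deriv (f := Lphi) h2 ?_
  simp
  ring

lemma hasDerivAt_Lphi' {y : ℝ} (hy : 0 < y) : HasDerivAt Lphi (Zfun y / y * Lphi y) y := by
  refine (hasDerivAt_Lphi y).congr_deriv ?_
  unfold Zfun Lphi
  field_simp

lemma Lphi_one : Lphi 1 = 1 := by norm_num [Lphi]

lemma Lphi_pos {y : ℝ} (hy : 0 < y) : 0 < Lphi y := by unfold Lphi; positivity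

lemma Lphi_le {y : ℝ} (hy : 0 < y) : Lphi y ≤ 2 * y := by
  unfold Lphi
  exact div_le_self (by positivity) (by nlinarith [sq_nonneg y])

lemma continuous_Lphi : Continuous Lphi :=
  continuous_iff_continuousAt.2 fun y => (hasDerivAt_Lphi y).continuousAt

lemma integrableOn_Ioi_of_bounded_support {F : ℝ → ℝ} {K R : ℝ} (hF : ContinuousOn F (Ioi 0))
    (hK : ∀ y, 0 < y → y ≤ R → |F y| ≤ K) (h0 : ∀ y, R ≤ y → F y = 0) :
    IntegrableOn F (Ioi 0) := by
  have h1 : IntegrableOn F (Ioc 0 R) :=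
    IntegrableOn.of_bound measure_Ioc_lt_top
      ((hF.mono fun y hy => hy.1).aestronglyMeasurable measurableSet_Ioc) K
      ((ae_restrict_iff' measurableSet_Ioc).2
        (Filter.Eventually.of_forall fun y hy => hK y hy.1 hy.2))
  refine h1.of_forall_sdiff_eq_zero measurableSet_Ioi fun y hy => h0 y ?_
  by_contra! h
  exact hy.2 ⟨hy.1, h.le⟩

/-- Coercivity of `A` on functions orthogonal to a compactly supported profile which is not
orthogonal to the resonance. -/
lemma coercive_Aop (n : ℕ) {Φ wt : ℝ → ℝ} {B R K₀ : ℝ} (hΦc : ContinuousOn Φ (Ioi 0))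
    (hB : 0 ≤ B) (hΦb : ∀ y, 0 < y → |Φ y| ≤ B * y) (hΦ0 : ∀ y, R ≤ y → Φ y = 0)
    (hD : 0 < ip Lphi Φ) (hwc : ContinuousOn wt (Ioi 0)) (hw0 : ∀ y, 0 < y → 0 < wt y)
    (hwn : ∀ y, 0 < y → y ≤ 1 → wt y * (y ^ 3 * (1 + |Real.log y|) ^ 2) ≤ 1)
    (hwf : ∀ y, 1 ≤ y → wt y * (y ^ (n + 3) * (1 + |Real.log y|) ^ 2) ≤ 1)
    (hwb : ∀ y, 0 < y → y ≤ R → 1 ≤ K₀ * wt y) :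
    ∃ C : ℝ, 0 < C ∧ ∀ u q k : ℝ → ℝ,
      (∀ y, 0 < y → HasDerivAt u (-q y + Zfun y / y * u y) y) →
      IntegrableOn k (Ioi 0) → (∀ y, 0 < y → 0 ≤ k y) →
      (∀ y, 0 < y → y ≤ 1 → 4 * q y ^ 2 ≤ k y * y) →
      (∀ y, 1 ≤ y → 4 * q y ^ 2 ≤ k y * (y ^ (n + 1) * (1 + |Real.log y|) ^ 2)) →
      ip u Φ = 0 →
      IntegrableOn (fun y => u y ^ 2 * wt y) (Ioi 0) ∧
        ∫ y in Ioi (0:ℝ), u y ^ 2 * wt y ≤ C * ∫ y in Ioi (0:ℝ), k y := by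
  set D := ip Lphi Φ with hDdef
  set κ := ∫ y in Ioi (0:ℝ), Φ y ^ 2 * y ^ 2 / wt y with hκ
  have hκ0 : 0 ≤ κ := setIntegral_nonneg measurableSet_Ioi fun y hy => by
    have := hw0 y hy; positivity
  have hκI : IntegrableOn (fun y => Φ y ^ 2 * y ^ 2 / wt y) (Ioi 0) := by
    refine integrableOn_Ioi_of_bounded_support (K := (B * R) ^ 2 * R ^ 2 * K₀) (R := R)
      (((hΦc.pow 2).mul (continuousOn_id.pow 2)).div hwc fun y hy => (hw0 y hy).ne')
      (fun y hy hyR => ?_) (fun y hy => by simp [hΦ0 y hy])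
    have h1 := hw0 y hy
    have h2 := hΦb y hy
    have h3 := hwb y hy hyR
    rw [abs_of_nonneg (by positivity), div_le_iff₀ h1]
    have h4 : Φ y ^ 2 ≤ (B * R) ^ 2 := by
      rw [← sq_abs (Φ y)]
      exact pow_le_pow_left₀ (abs_nonneg _) (h2.trans (mul_le_mul_of_nonneg_left hyR hB)) 2
    have h5 : y ^ 2 ≤ R ^ 2 := pow_le_pow_left₀ hy.le hyR 2
    calc Φ y ^ 2 * y ^ 2 ≤ (B * R) ^ 2 * R ^ 2 := by gcongr
      _ ≤ (B * R) ^ 2 * R ^ 2 * (K₀ * wt y) := le_mul_of_one_le_right (by positivity) h3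
      _ = _ := by ring
  have hLI : IntegrableOn (fun y => Lphi y * Φ y * y) (Ioi 0) := by
    refine integrableOn_Ioi_of_bounded_support (K := 2 * R * (B * R) * R) (R := R)
      ((continuous_Lphi.continuousOn.mul hΦc).mul continuousOn_id)
      (fun y hy hyR => ?_) (fun y hy => by simp [hΦ0 y hy])
    have hR : 0 ≤ R := hy.le.trans hyR
    rw [abs_mul, abs_mul, abs_of_pos (Lphi_pos hy), abs_of_pos hy]
    have h1 := (Lphi_le hy).trans (by linarith : 2 * y ≤ 2 * R)
    have h2 := (hΦb y hy).trans (mul_le_mul_of_nonneg_left hyR hB)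
    have h3 := (Lphi_pos hy).le
    gcongr
  set t := D / (κ + 1) with ht
  have ht0 : 0 < t := by positivity
  have htκ : t * κ ≤ D := by
    rw [ht, div_mul_eq_mul_div, div_le_iff₀ (by positivity)]; nlinarith
  refine ⟨64 / (t * D) + 4, by positivity, fun u q k hu hk hk0 hkn hkf hort => ?_⟩
  have huc : ContinuousOn u (Ioi 0) := fun y hy => (hu y hy).continuousAt.continuousWithinAt
  have hmain : ∀ r : ℝ → ℝ, (∀ y, 0 < y → HasDerivAt r (-q y + Zfun y / y * r y) y) →
      IntegrableOn (fun y => r y ^ 2 * wt y) (Ioi 0) ∧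
      ∫ y in Ioi (0:ℝ), r y ^ 2 * wt y ≤ 16 * r 1 ^ 2 + 4 * ∫ y in Ioi (0:ℝ), k y := by
    intro r hr
    have hrc : ContinuousOn r (Ioi 0) := fun y hy => (hr y hy).continuousAt.continuousWithinAt
    refine hardy_Aop n hr ((hrc.pow 2).mul hwc)
      (fun y hy => mul_nonneg (sq_nonneg _) (hw0 y hy).le) hk hk0 (fun y hy hy1 => ?_)
      (fun y hy => ?_) hkn hkf
    · have := mul_le_mul_of_nonneg_left (hwn y hy hy1) (sq_nonneg (r y))
      linarith
    · have := mul_le_mul_of_nonneg_left (hwf y hy) (sq_nonneg (r y))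
      linarith
  set c := u 1 with hc
  set r : ℝ → ℝ := fun y => u y - c * Lphi y with hr
  obtain ⟨hrI, hrle⟩ := hmain r fun y hy => by
    refine ((hu y hy).sub ((hasDerivAt_Lphi' hy).const_mul c)).congr_deriv ?_
    simp only [hr]; ring
  have hr1 : r 1 = 0 := by simp [hr, Lphi_one, hc]
  have hrc : ContinuousOn r (Ioi 0) := huc.sub (continuous_Lphi.continuousOn.const_smul c)
  obtain ⟨huI, hule⟩ := hmain u hu
  refine ⟨huI, hule.trans ?_⟩
  have hrΦI : IntegrableOn (fun y => r y * Φ y * y) (Ioi 0) := by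
    refine Integrable.mono' (hrI.add hκI) (((hrc.mul hΦc).mul
      continuousOn_id).aestronglyMeasurable measurableSet_Ioi) ?_
    refine (ae_restrict_iff' measurableSet_Ioi).2 (Filter.Eventually.of_forall fun y hy => ?_)
    have h1 := hw0 y hy
    rw [Real.norm_eq_abs, Pi.add_apply, abs_le]
    have e1 : ∀ s : ℝ, 0 ≤ (r y + s * (Φ y * y / wt y)) ^ 2 * wt y :=
      fun s => mul_nonneg (sq_nonneg _) h1.le
    have e2 : ∀ s : ℝ, (r y + s * (Φ y * y / wt y)) ^ 2 * wt y = r y ^ 2 * wt y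
      + 2 * s * (r y * Φ y * y) + s ^ 2 * (Φ y ^ 2 * y ^ 2 / wt y) := fun s => by field_simp; ring
    have p1 := e1 1
    have p2 := e1 (-1)
    have p3 : 0 ≤ r y ^ 2 * wt y := mul_nonneg (sq_nonneg _) h1.le
    have p4 : 0 ≤ Φ y ^ 2 * y ^ 2 / wt y := by positivity
    rw [e2] at p1 p2
    constructor <;> linarith
  have hdec : ip u Φ = c * D + ∫ y in Ioi (0:ℝ), r y * Φ y * y := by
    rw [hDdef, ip, ip, ← integral_const_mul, ← integral_add (hLI.const_mul c) hrΦI]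
    congr 1
    ext y
    simp only [hr]; ring
  have hquad : 0 ≤ ∫ y in Ioi (0:ℝ), (1 / t * (r y ^ 2 * wt y) + 2 * c * (r y * Φ y * y)
      + t * c ^ 2 * (Φ y ^ 2 * y ^ 2 / wt y)) := by
    refine setIntegral_nonneg measurableSet_Ioi fun y hy => ?_
    have h1 := hw0 y hy
    have : 1 / t * (r y ^ 2 * wt y) + 2 * c * (r y * Φ y * y)
      + t * c ^ 2 * (Φ y ^ 2 * y ^ 2 / wt y)
      = 1 / t * (r y + t * c * (Φ y * y / wt y)) ^ 2 * wt y := by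
      field_simp; ring
    rw [this]
    positivity
  have hsumI : IntegrableOn (fun y => 1 / t * (r y ^ 2 * wt y) + 2 * c * (r y * Φ y * y))
      (Ioi 0) := (hrI.const_mul _).add (hrΦI.const_mul _)
  rw [integral_add hsumI (hκI.const_mul _),
    integral_add (hrI.const_mul _) (hrΦI.const_mul _), integral_const_mul, integral_const_mul,
    integral_const_mul, ← hκ] at hquad
  have h1 : ∫ y in Ioi (0:ℝ), r y * Φ y * y = -(c * D) := by linarith
  rw [hr1] at hrle
  rw [h1] at hquad
  have h2 : c ^ 2 * (t * κ) ≤ c ^ 2 * D := mul_le_mul_of_nonneg_left htκ (sq_nonneg c)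
  have h3 : c ^ 2 * D ≤ 1 / t * (4 * ∫ y in Ioi (0:ℝ), k y) := by
    have : 1 / t * ∫ y in Ioi (0:ℝ), r y ^ 2 * wt y ≤ 1 / t * (4 * ∫ y in Ioi (0:ℝ), k y) :=
      mul_le_mul_of_nonneg_left (by linarith) (by positivity)
    nlinarith
  have h4 : c ^ 2 ≤ 1 / t * (4 * ∫ y in Ioi (0:ℝ), k y) / D := by
    rwa [le_div_iff₀ hD]
  have h5 : 16 * (1 / t * (4 * ∫ y in Ioi (0:ℝ), k y) / D)
      = 64 / (t * D) * ∫ y in Ioi (0:ℝ), k y := by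
    field_simp; ring
  linarith

lemma hasDerivAt_deriv_Lphi (y : ℝ) :
    HasDerivAt (fun y : ℝ => 2 * (1 - y ^ 2) / (1 + y ^ 2) ^ 2)
      (4 * y * (y ^ 2 - 3) / (1 + y ^ 2) ^ 3) y := by
  have hid := hasDerivAt_id y
  refine ((((hid.pow 2).const_sub 1).const_mul 2).div (((hid.pow 2).const_add 1).pow 2)
    (by simp only [id, Pi.pow_apply]; positivity)).congr_deriv ?_
  simp only [id, Pi.pow_apply]
  field_simp
  ring

lemma Hop_mul_Lphi {X : ℝ → ℝ} (hX : ContDiff ℝ 2 X) {y : ℝ} (hy : 0 < y) :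
    Hop (fun y => X y * Lphi y) y = -(deriv (deriv X) y * Lphi y
      + 2 * deriv X y * (2 * (1 - y ^ 2) / (1 + y ^ 2) ^ 2) + deriv X y * Lphi y / y) := by
  have hX1 : ContDiff ℝ 1 (deriv X) := hX.deriv'
  have d0 : ∀ z, HasDerivAt X (deriv X z) z := fun z =>
    (hX.differentiable (by norm_num) z).hasDerivAt
  have d1 : ∀ z, HasDerivAt (deriv X) (deriv (deriv X) z) z := fun z =>
    (hX1.differentiable (by norm_num) z).hasDerivAt
  have e1 : deriv (fun y => X y * Lphi y) = fun y => deriv X y * Lphi y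
      + X y * (2 * (1 - y ^ 2) / (1 + y ^ 2) ^ 2) :=
    funext fun z => ((d0 z).mul (hasDerivAt_Lphi z)).deriv
  have e2 : deriv (fun y => deriv X y * Lphi y + X y * (2 * (1 - y ^ 2) / (1 + y ^ 2) ^ 2)) y = _ :=
    (((d1 y).mul (hasDerivAt_Lphi y)).add ((d0 y).mul (hasDerivAt_deriv_Lphi y))).deriv
  rw [Hop, e1, e2]
  simp only [Lphi, Vfun]
  field_simp
  ring

/-- Cutoff equal to one before `M` and vanishing after `2M`. -/
structure IsCutoffAt (X : ℝ → ℝ) (M : ℝ) : Prop where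
  pos : 0 < M
  contDiff : ContDiff ℝ 2 X
  eq_one : ∀ y, y ≤ M → X y = 1
  eq_zero : ∀ y, 2 * M ≤ y → X y = 0
  nonneg : ∀ y, 0 ≤ X y
  le_one : ∀ y, X y ≤ 1

namespace IsCutoffAt

variable {X : ℝ → ℝ} {M : ℝ}

lemma hasDerivAt (h : IsCutoffAt X M) (y : ℝ) : HasDerivAt X (deriv X y) y :=
  (h.contDiff.differentiable (by norm_num) y).hasDerivAt

lemma hasDerivAt_deriv (h : IsCutoffAt X M) (y : ℝ) :
    HasDerivAt (deriv X) (deriv (deriv X) y) y :=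
  ((h.contDiff.deriv' : ContDiff ℝ 1 (deriv X)).differentiable (by norm_num) y).hasDerivAt

lemma continuous_deriv_deriv (h : IsCutoffAt X M) : Continuous (deriv (deriv X)) :=
  (h.contDiff.deriv' : ContDiff ℝ 1 (deriv X)).continuous_deriv le_rfl

lemma deriv_eq_zero (h : IsCutoffAt X M) {y : ℝ} (hy : y < M ∨ 2 * M < y) :
    deriv X y = 0 ∧ deriv (deriv X) y = 0 := by
  have key : ∀ (c : ℝ) (U : Set ℝ), IsOpen U → (∀ z ∈ U, X z = c) →
      ∀ z ∈ U, deriv X z = 0 ∧ deriv (deriv X) z = 0 := by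
    intro c U hU hc
    have h1 : ∀ z ∈ U, deriv X z = 0 := fun z hz => by
      rw [(Filter.eventuallyEq_of_mem (hU.mem_nhds hz) hc : X =ᶠ[nhds z] fun _ => c).deriv_eq]
      simp
    refine fun z hz => ⟨h1 z hz, ?_⟩
    rw [(Filter.eventuallyEq_of_mem (hU.mem_nhds hz) h1 : deriv X =ᶠ[nhds z] fun _ => 0).deriv_eq]
    simp
  rcases hy with hy | hy
  · exact key 1 (Iio M) isOpen_Iio (fun z hz => h.eq_one z hz.le) y hy
  · exact key 0 (Ioi (2 * M)) isOpen_Ioi (fun z hz => h.eq_zero z (le_of_lt hz)) y hy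

lemma Hop_eq_zero (h : IsCutoffAt X M) {y : ℝ} (hy : 0 < y) (hyM : y < M ∨ 2 * M < y) :
    Hop (fun y => X y * Lphi y) y = 0 := by
  rw [Hop_mul_Lphi h.contDiff hy, (h.deriv_eq_zero hyM).1, (h.deriv_eq_zero hyM).2]
  ring

lemma continuousOn_Hop (h : IsCutoffAt X M) :
    ContinuousOn (Hop (fun y => X y * Lphi y)) (Ioi 0) := by
  have c1 : Continuous (deriv X) := continuous_iff_continuousAt.2 fun y =>
    (h.hasDerivAt_deriv y).continuousAt
  have c2 := h.continuous_deriv_deriv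
  have c3 : Continuous (fun y : ℝ => 2 * (1 - y ^ 2) / (1 + y ^ 2) ^ 2) :=
    continuous_iff_continuousAt.2 fun y => (hasDerivAt_deriv_Lphi y).continuousAt
  refine ContinuousOn.congr (f := fun y => -(deriv (deriv X) y * Lphi y
      + 2 * deriv X y * (2 * (1 - y ^ 2) / (1 + y ^ 2) ^ 2) + deriv X y * Lphi y / y)) ?_
    fun y hy => Hop_mul_Lphi h.contDiff hy
  exact (((c2.mul continuous_Lphi).add ((c1.const_smul (2 : ℝ)).mul c3)).continuousOn.add
    ((c1.mul continuous_Lphi).continuousOn.div continuousOn_id fun y hy => ne_of_gt hy)).neg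

lemma exists_abs_Hop_le (h : IsCutoffAt X M) :
    ∃ B, 0 ≤ B ∧ ∀ y, 0 < y → |Hop (fun y => X y * Lphi y) y| ≤ B * y := by
  have hM := h.pos
  have hc : ContinuousOn (fun y => Hop (fun y => X y * Lphi y) y / y) (Icc M (2 * M)) :=
    (h.continuousOn_Hop.div continuousOn_id fun y hy => ne_of_gt hy).mono
      fun y hy => hM.trans_le hy.1
  obtain ⟨B, hB⟩ := isCompact_Icc.exists_bound_of_continuousOn hc
  refine ⟨max B 0, le_max_right _ _, fun y hy => ?_⟩
  by_cases hyM : y ∈ Icc M (2 * M)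
  · have := hB y hyM
    rw [norm_div, div_le_iff₀ (norm_pos_iff.2 hy.ne'), Real.norm_eq_abs, Real.norm_eq_abs,
      abs_of_pos hy] at this
    exact this.trans (mul_le_mul_of_nonneg_right (le_max_left _ _) hy.le)
  · rw [h.Hop_eq_zero hy, abs_zero]
    · exact mul_nonneg (le_max_right _ _) hy.le
    · by_contra! hcon
      exact hyM ⟨hcon.1, hcon.2⟩

lemma ip_Hop_eq_intervalIntegral (h : IsCutoffAt X M) (g : ℝ → ℝ) :
    ip (Hop (fun y => X y * Lphi y)) g
      = ∫ y in (M / 2)..(3 * M), Hop (fun y => X y * Lphi y) y * g y * y := by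
  have hM := h.pos
  rw [ip, intervalIntegral.integral_of_le (by linarith)]
  refine setIntegral_eq_of_subset_of_forall_sdiff_eq_zero measurableSet_Ioi
    (fun y hy => (by linarith [hy.1] : 0 < y)) fun y hy => ?_
  have hy0 : 0 < y := hy.1
  rw [h.Hop_eq_zero hy0]
  · ring
  · by_contra! hcon
    exact hy.2 ⟨by linarith [hcon.1], by linarith [hcon.2]⟩

lemma hasDerivAt_flux (h : IsCutoffAt X M) {y : ℝ} (hy : 0 < y) :
    HasDerivAt (fun y => y * Lphi y ^ 2 * deriv X y)
      (-(Hop (fun y => X y * Lphi y) y * Lphi y * y)) y := by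
  refine (((hasDerivAt_id y).mul ((hasDerivAt_Lphi y).pow 2)).mul
    (h.hasDerivAt_deriv y)).congr_deriv ?_
  rw [Hop_mul_Lphi h.contDiff hy]
  simp only [id, Pi.mul_apply, Pi.pow_apply]
  field_simp
  ring

lemma ip_Hop_Lphi (h : IsCutoffAt X M) : ip (Hop (fun y => X y * Lphi y)) Lphi = 0 := by
  have hM := h.pos
  have hsub : ∀ y ∈ uIcc (M / 2) (3 * M), 0 < y := fun y hy => by
    rw [uIcc_of_le (by linarith)] at hy
    linarith [hy.1]
  have hcont : ContinuousOn (fun y => Hop (fun y => X y * Lphi y) y * Lphi y * y) (Ioi 0) :=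
    (h.continuousOn_Hop.mul continuous_Lphi.continuousOn).mul continuousOn_id
  have := intervalIntegral.integral_eq_sub_of_hasDerivAt
    (fun y hy => h.hasDerivAt_flux (hsub y hy)) (hcont.mono hsub).neg.intervalIntegrable
  rw [(h.deriv_eq_zero (y := M / 2) (Or.inl (by linarith))).1,
    (h.deriv_eq_zero (y := 3 * M) (Or.inr (by linarith))).1, intervalIntegral.integral_neg] at this
  rw [h.ip_Hop_eq_intervalIntegral]
  linarith

end IsCutoffAt

lemma continuous_log_one_add_sq_div : Continuous fun s : ℝ => Real.log (1 + s ^ 2) / s := by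
  rw [continuous_iff_continuousAt]
  intro s
  rcases eq_or_ne s 0 with rfl | hs
  · rw [ContinuousAt, div_zero]
    refine squeeze_zero_norm (a := fun s : ℝ => |s|) (fun s => ?_) ?_
    · rcases eq_or_ne s 0 with rfl | hs
      · simp
      · have h1 : Real.log (1 + s ^ 2) ≤ s ^ 2 := by
          have := Real.log_le_sub_one_of_pos (by positivity : 0 < 1 + s ^ 2)
          linarith
        have h2 : 0 ≤ Real.log (1 + s ^ 2) := Real.log_nonneg (by nlinarith)
        rw [norm_div, Real.norm_eq_abs, Real.norm_eq_abs, abs_of_nonneg h2,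
          div_le_iff₀ (abs_pos.2 hs), abs_mul_abs_self]
        linarith
    · simpa using (continuous_abs.tendsto (0 : ℝ))
  · exact (ContinuousAt.log (by fun_prop) (by positivity)).div continuousAt_id hs

/-- The quotient `T₁/Λφ`. -/
def T1quot (y : ℝ) : ℝ :=
  -((1 - y ^ 4) * Real.log (1 + y ^ 2) + 2 * y ^ 4 - y ^ 2
      - 4 * y ^ 2 * ∫ s in (0:ℝ)..y, Real.log (1 + s ^ 2) / s) / (4 * y ^ 2)

lemma T1_eq {y : ℝ} (hy : 0 < y) : T1 y = Lphi y * T1quot y := by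
  unfold T1 T1quot Lphi
  field_simp
  ring

/-- The antiderivative `2 (log (1+y²) - y²/(1+y²))` of `y (Λφ)²`. -/
def resonanceMass (y : ℝ) : ℝ := 2 * (Real.log (1 + y ^ 2) - y ^ 2 / (1 + y ^ 2))

lemma hasDerivAt_log_one_add_sq (y : ℝ) :
    HasDerivAt (fun y : ℝ => Real.log (1 + y ^ 2)) (2 * y / (1 + y ^ 2)) y := by
  have := (((hasDerivAt_id y).pow 2).const_add 1).log (by simp only [id, Pi.pow_apply]; positivity)
  refine this.congr_deriv ?_
  simp only [id, Pi.pow_apply]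
  ring

lemma hasDerivAt_T1quot {y : ℝ} (hy : 0 < y) :
    HasDerivAt T1quot (resonanceMass y / (y * Lphi y ^ 2)) y := by
  have hid := hasDerivAt_id y
  have hl := hasDerivAt_log_one_add_sq y
  have hI : HasDerivAt (fun y => ∫ s in (0:ℝ)..y, Real.log (1 + s ^ 2) / s)
      (Real.log (1 + y ^ 2) / y) y :=
    continuous_log_one_add_sq_div.integral_hasStrictDerivAt 0 y |>.hasDerivAt
  have hd := (((((((hid.pow 4).const_sub 1).mul hl).add ((hid.pow 4).const_mul 2)).sub
    (hid.pow 2)).sub (((hid.pow 2).const_mul 4).mul hI)).neg).div ((hid.pow 2).const_mul 4)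
    (by simp only [id, Pi.pow_apply]; positivity)
  refine HasDerivAt.congr_deriv (f := T1quot) hd ?_
  simp only [id, Pi.mul_apply, Pi.pow_apply, Pi.sub_apply, Pi.add_apply, Pi.neg_apply,
    resonanceMass, Lphi]
  field_simp
  ring

lemma hasDerivAt_resonanceMass (y : ℝ) : HasDerivAt resonanceMass (y * Lphi y ^ 2) y := by
  have hid := hasDerivAt_id y
  refine HasDerivAt.congr_deriv (f := resonanceMass) (((hasDerivAt_log_one_add_sq y).sub
    ((hid.pow 2).div ((hid.pow 2).const_add 1)
      (by simp only [id, Pi.pow_apply]; positivity))).const_mul 2) ?_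
  simp only [id, Pi.pow_apply, Lphi]
  field_simp
  ring

lemma resonanceMass_pos {y : ℝ} (hy : 0 < y) : 0 < resonanceMass y := by
  have h := Real.log_lt_sub_one_of_pos (x := (1 + y ^ 2)⁻¹) (by positivity)
    (by rw [Ne, inv_eq_one]; nlinarith [pow_pos hy 2])
  rw [Real.log_inv] at h
  have : y ^ 2 / (1 + y ^ 2) = 1 - (1 + y ^ 2)⁻¹ := by field_simp; ring
  unfold resonanceMass
  linarith

namespace IsCutoffAt

variable {X : ℝ → ℝ} {M : ℝ}

/-- The cutoff resonance is never orthogonal to the image of `T₁` under `H`. -/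
lemma ip_Hop_T1_neg (h : IsCutoffAt X M) : ip (Hop (fun y => X y * Lphi y)) T1 < 0 := by
  have hM := h.pos
  have hle : M / 2 ≤ 3 * M := by linarith
  have hsub : ∀ y ∈ uIcc (M / 2) (3 * M), 0 < y := fun y hy => by
    rw [uIcc_of_le hle] at hy
    linarith [hy.1]
  have hS : ContinuousOn T1quot (Ioi 0) :=
    fun y hy => (hasDerivAt_T1quot hy).continuousAt.continuousWithinAt
  have hX : Continuous X := h.contDiff.continuous
  have hc1 : ContinuousOn (fun y => Hop (fun y => X y * Lphi y) y * (Lphi y * T1quot y) * y)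
      (Ioi 0) :=
    (h.continuousOn_Hop.mul (continuous_Lphi.continuousOn.mul hS)).mul continuousOn_id
  have hc2 : Continuous (fun y => X y * (y * Lphi y ^ 2)) :=
    hX.mul (continuous_id.mul (continuous_Lphi.pow 2))
  have hd : ∀ y ∈ uIcc (M / 2) (3 * M), HasDerivAt
      (fun y => -(y * Lphi y ^ 2 * deriv X y * T1quot y) + resonanceMass y * X y)
      (Hop (fun y => X y * Lphi y) y * (Lphi y * T1quot y) * y + X y * (y * Lphi y ^ 2)) y := by
    intro y hy
    have hy0 := hsub y hy
    have hL := Lphi_pos hy0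
    refine ((((h.hasDerivAt_flux hy0).mul (hasDerivAt_T1quot hy0)).neg).add
      ((hasDerivAt_resonanceMass y).mul (h.hasDerivAt y))).congr_deriv ?_
    field_simp
    ring
  have h_integral := intervalIntegral.integral_eq_sub_of_hasDerivAt hd
    ((hc1.mono hsub).add hc2.continuousOn).intervalIntegrable
  rw [(h.deriv_eq_zero (y := M / 2) (Or.inl (by linarith))).1,
    (h.deriv_eq_zero (y := 3 * M) (Or.inr (by linarith))).1,
    h.eq_one (M / 2) (by linarith), h.eq_zero (3 * M) (by linarith),
    intervalIntegral.integral_add (hc1.mono hsub).intervalIntegrable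
      (hc2.intervalIntegrable _ _)] at h_integral
  have hpos : 0 ≤ ∫ y in (M / 2)..(3 * M), X y * (y * Lphi y ^ 2) :=
    intervalIntegral.integral_nonneg hle fun y hy =>
      mul_nonneg (h.nonneg y) (mul_nonneg (by linarith [hy.1]) (sq_nonneg _))
  have hW := resonanceMass_pos (half_pos hM)
  rw [h.ip_Hop_eq_intervalIntegral, intervalIntegral.integral_congr
    (g := fun y => Hop (fun y => X y * Lphi y) y * (Lphi y * T1quot y) * y)
    fun y hy => by simp only [T1_eq (hsub y hy)]]
  linarith

lemma ip_Lphi_pos (h : IsCutoffAt X M) (c : ℝ) :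
    0 < ip Lphi (fun y => X y * Lphi y - c * Hop (fun y => X y * Lphi y) y) := by
  have hM := h.pos
  have hX : Continuous X := h.contDiff.continuous
  obtain ⟨B, hB0, hB⟩ := h.exists_abs_Hop_le
  have hc : Continuous (fun y => X y * Lphi y ^ 2 * y) :=
    (hX.mul (continuous_Lphi.pow 2)).mul continuous_id
  have h1 : IntegrableOn (fun y => X y * Lphi y ^ 2 * y) (Ioi 0) := by
    obtain ⟨K, hK⟩ := isCompact_Icc.exists_bound_of_continuousOn
      (s := Icc 0 (2 * M)) hc.continuousOn
    exact integrableOn_Ioi_of_bounded_support hc.continuousOn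
      (fun y hy hy2 => hK y ⟨hy.le, hy2⟩) fun y hy => by rw [h.eq_zero y hy]; ring
  have h2 : IntegrableOn (fun y => Hop (fun y => X y * Lphi y) y * Lphi y * y) (Ioi 0) := by
    refine integrableOn_Ioi_of_bounded_support (R := 3 * M)
      (K := B * (3 * M) * (2 * (3 * M)) * (3 * M))
      ((h.continuousOn_Hop.mul continuous_Lphi.continuousOn).mul continuousOn_id)
      (fun y hy hyR => ?_) fun y hy => by
        rw [h.Hop_eq_zero (by linarith) (Or.inr (by linarith))]; ring
    rw [abs_mul, abs_mul, abs_of_pos (Lphi_pos hy), abs_of_pos hy]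
    have e1 := (Lphi_le hy).trans (by linarith : 2 * y ≤ 2 * (3 * M))
    have e2 := (hB y hy).trans (mul_le_mul_of_nonneg_left hyR hB0)
    have e3 := (Lphi_pos hy).le
    gcongr
  have h3 : ip Lphi (fun y => X y * Lphi y - c * Hop (fun y => X y * Lphi y) y)
      = (∫ y in Ioi (0:ℝ), X y * Lphi y ^ 2 * y) - c * ip (Hop (fun y => X y * Lphi y)) Lphi := by
    rw [ip, ip, ← integral_const_mul, ← integral_sub h1 (h2.const_mul c)]
    congr 1
    ext y
    ring
  rw [h3, h.ip_Hop_Lphi, mul_zero, sub_zero]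
  have hpos : ∀ y, 0 < y → 0 ≤ X y * Lphi y ^ 2 * y := fun y hy =>
    mul_nonneg (mul_nonneg (h.nonneg y) (sq_nonneg _)) hy.le
  refine lt_of_lt_of_le ?_ (intervalIntegral_le_integral_Ioi h1 hpos (half_pos hM)
    (by linarith : M / 2 ≤ M))
  refine intervalIntegral.intervalIntegral_pos_of_pos_on (hc.intervalIntegrable _ _)
    (fun y hy => ?_) (by linarith)
  have hy0 : 0 < y := by linarith [hy.1]
  have := Lphi_pos hy0
  rw [h.eq_one y hy.2.le]
  positivity

lemma exists_abs_profile_le (h : IsCutoffAt X M) (c : ℝ) :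
    ∃ B, 0 ≤ B ∧ ∀ y, 0 < y →
      |X y * Lphi y - c * Hop (fun y => X y * Lphi y) y| ≤ B * y := by
  obtain ⟨B, hB0, hB⟩ := h.exists_abs_Hop_le
  refine ⟨2 + |c| * B, by positivity, fun y hy => (abs_sub _ _).trans ?_⟩
  rw [abs_mul, abs_mul, abs_of_nonneg (h.nonneg y), abs_of_pos (Lphi_pos hy), add_mul, mul_assoc]
  have h1 := mul_le_mul_of_nonneg_left (hB y hy) (abs_nonneg c)
  have h2 := mul_le_mul (h.le_one y) (Lphi_le hy) (Lphi_pos hy).le zero_le_one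
  linarith

lemma continuousOn_profile (h : IsCutoffAt X M) (c : ℝ) :
    ContinuousOn (fun y => X y * Lphi y - c * Hop (fun y => X y * Lphi y) y) (Ioi 0) :=
  (h.contDiff.continuous.mul continuous_Lphi).continuousOn.sub (h.continuousOn_Hop.const_smul c)

lemma profile_eq_zero (h : IsCutoffAt X M) (c : ℝ) {y : ℝ} (hy : 3 * M ≤ y) :
    X y * Lphi y - c * Hop (fun y => X y * Lphi y) y = 0 := by
  have hM := h.pos
  rw [h.Hop_eq_zero (by linarith) (Or.inr (by linarith)), h.eq_zero y (by linarith)]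
  ring

end IsCutoffAt

lemma isCutoffAt_comp_div {χ : ℝ → ℝ} (hχ : ContDiff ℝ (⊤ : ℕ∞) χ)
    (hχ1 : ∀ y : ℝ, y ≤ 1 → χ y = 1) (hχ0 : ∀ y : ℝ, 2 ≤ y → χ y = 0)
    (hχr : ∀ y : ℝ, 0 ≤ χ y ∧ χ y ≤ 1) {M : ℝ} (hM : 0 < M) :
    IsCutoffAt (fun y => χ (y / M)) M where
  pos := hM
  contDiff := (hχ.of_le (WithTop.coe_le_coe.2 le_top)).comp (contDiff_id.div_const M)
  eq_one _ hy := hχ1 _ ((div_le_one hM).2 hy)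
  eq_zero _ hy := hχ0 _ ((le_div_iff₀ hM).2 hy)
  nonneg _ := (hχr _).1
  le_one _ := (hχr _).2

lemma hasDerivAt_of_Aop {u : ℝ → ℝ} {y : ℝ} (hu : DifferentiableAt ℝ u y) :
    HasDerivAt u (-Aop u y + Zfun y / y * u y) y := by
  refine hu.hasDerivAt.congr_deriv ?_
  unfold Aop; ring

lemma hasDerivAt_Aop {u : ℝ → ℝ} {y : ℝ} (hy : 0 < y) (hu : DifferentiableAt ℝ u y)
    (hu' : DifferentiableAt ℝ (deriv u) y) :
    HasDerivAt (Aop u) (Hop u y - 2 / (y * (1 + y ^ 2)) * Aop u y) y := by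
  have h0 : 1 + y ^ 2 ≠ 0 := by positivity
  have hZ := (((((hasDerivAt_id y).pow 2).const_sub 1).div
    (((hasDerivAt_id y).pow 2).const_add 1) h0).div (hasDerivAt_id y) hy.ne')
  refine HasDerivAt.congr_deriv (f := Aop u)
    (hu'.hasDerivAt.neg.add (hZ.mul hu.hasDerivAt)) ?_
  simp only [Hop, Aop, Zfun, Vfun, id, Pi.pow_apply, Pi.div_apply]
  field_simp
  ring

lemma contDiffOn_Hop {u : ℝ → ℝ} {n : ℕ} (hu : ContDiffOn ℝ (n + 2 : ℕ) u (Ioi 0)) :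
    ContDiffOn ℝ n (Hop u) (Ioi 0) := by
  have h1 : ContDiffOn ℝ (n + 1 : ℕ) (deriv u) (Ioi 0) :=
    hu.deriv_of_isOpen isOpen_Ioi (by norm_cast)
  have h2 : ContDiffOn ℝ n (deriv (deriv u)) (Ioi 0) :=
    h1.deriv_of_isOpen isOpen_Ioi (by norm_cast)
  have hid : ContDiffOn ℝ n (fun y : ℝ => y) (Ioi 0) := contDiffOn_id
  have hV : ContDiffOn ℝ n Vfun (Ioi 0) :=
    ((((hid.pow 4).sub (contDiffOn_const.mul (hid.pow 2))).add contDiffOn_const).div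
      ((contDiffOn_const.add (hid.pow 2)).pow 2) fun y _ => by positivity)
  exact (h2.neg.sub ((h1.of_le (by norm_cast; omega)).div hid fun y hy => (ne_of_gt hy))).add
    ((hV.div (hid.pow 2) fun y hy => pow_ne_zero 2 (ne_of_gt hy)).mul
      (hu.of_le (by norm_cast; omega)))

lemma differentiableAt_deriv_of_contDiffOn {u : ℝ → ℝ} (hu : ContDiffOn ℝ 2 u (Ioi 0)) {y : ℝ}
    (hy : 0 < y) : DifferentiableAt ℝ u y ∧ DifferentiableAt ℝ (deriv u) y := by
  have h1 : ContDiffOn ℝ 1 (deriv u) (Ioi 0) := hu.deriv_of_isOpen isOpen_Ioi (by norm_num)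
  exact ⟨(hu.differentiableOn (by norm_num)).differentiableAt (Ioi_mem_nhds hy),
    (h1.differentiableOn (by norm_num)).differentiableAt (Ioi_mem_nhds hy)⟩

lemma deriv_eq_of_eqOn_Ioi {g G G' : ℝ → ℝ} (h : ∀ y, 0 < y → g y = G y)
    (hG : ∀ y, 0 < y → HasDerivAt G (G' y) y) : ∀ y, 0 < y → deriv g y = G' y := fun y hy =>
  ((hG y hy).congr_of_eventuallyEq
    (Filter.eventually_of_mem (Ioi_mem_nhds hy) fun z hz => h z hz)).deriv

/-- Expansion of the first four derivatives of `u` along `u, q, v, w, f`, where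
`q = Au`, `v = A*q`, `w = Av`, `f = A*w`. -/
lemma iterated_deriv_expansion {u q v w f : ℝ → ℝ}
    (hu : ∀ y, 0 < y → HasDerivAt u (-q y + Zfun y / y * u y) y)
    (hq : ∀ y, 0 < y → HasDerivAt q (v y - 2 / (y * (1 + y ^ 2)) * q y) y)
    (hv : ∀ y, 0 < y → HasDerivAt v (-w y + Zfun y / y * v y) y)
    (hw : ∀ y, 0 < y → HasDerivAt w (f y - 2 / (y * (1 + y ^ 2)) * w y) y) {y : ℝ} (hy : 0 < y) :
    deriv u y = -q y + (1 - y ^ 2) / (y * (1 + y ^ 2)) * u y ∧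
    deriv (deriv u) y = -v y + 1 / y * q y + 2 * (y ^ 2 - 3) / (1 + y ^ 2) ^ 2 * u y ∧
    deriv (deriv (deriv u)) y = w y + 2 * y / (1 + y ^ 2) * v y
      - (3 * y ^ 4 - 2 * y ^ 2 + 3) / (y ^ 2 * (1 + y ^ 2) ^ 2) * q y
      - 6 * (y ^ 4 - 6 * y ^ 2 + 1) / (y * (1 + y ^ 2) ^ 3) * u y ∧
    deriv (deriv (deriv (deriv u))) y = f y - 2 / y * w y
      + (-7 * y ^ 4 + 6 * y ^ 2 - 3) / (y ^ 2 * (1 + y ^ 2) ^ 2) * v y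
      + (12 * y ^ 6 - 44 * y ^ 4 + 20 * y ^ 2 + 12) / (y ^ 3 * (1 + y ^ 2) ^ 3) * q y
      + 24 * (y ^ 4 - 10 * y ^ 2 + 5) / (1 + y ^ 2) ^ 4 * u y := by
  have e1 : ∀ y, 0 < y → deriv u y = -q y + (1 - y ^ 2) / (y * (1 + y ^ 2)) * u y :=
    fun y hy => by rw [(hu y hy).deriv, Zfun]; field_simp
  have e2 := deriv_eq_of_eqOn_Ioi (G' := fun y =>
      -v y + 1 / y * q y + 2 * (y ^ 2 - 3) / (1 + y ^ 2) ^ 2 * u y) e1 fun y hy => by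
    have hid := hasDerivAt_id y
    have c := ((hid.pow 2).const_sub 1).div (hid.mul ((hid.pow 2).const_add 1))
      (by simp only [id, Pi.mul_apply, Pi.pow_apply]; positivity)
    refine ((hq y hy).neg.add (c.mul (hu y hy))).congr_deriv ?_
    simp only [id, Pi.mul_apply, Pi.pow_apply, Pi.div_apply, Zfun]
    field_simp
    ring
  have e3 := deriv_eq_of_eqOn_Ioi (G' := fun y => w y + 2 * y / (1 + y ^ 2) * v y
      - (3 * y ^ 4 - 2 * y ^ 2 + 3) / (y ^ 2 * (1 + y ^ 2) ^ 2) * q y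
      - 6 * (y ^ 4 - 6 * y ^ 2 + 1) / (y * (1 + y ^ 2) ^ 3) * u y) e2 fun y hy => by
    have hid := hasDerivAt_id y
    have c1 := (hasDerivAt_const y (1 : ℝ)).div hid hy.ne'
    have c := (((hid.pow 2).sub_const 3).const_mul 2).div (((hid.pow 2).const_add 1).pow 2)
      (by simp only [id, Pi.pow_apply]; positivity)
    refine (((hv y hy).neg.add (c1.mul (hq y hy))).add (c.mul (hu y hy))).congr_deriv ?_
    simp only [id, Pi.pow_apply, Pi.div_apply, Zfun]
    field_simp
    ring
  have e4 := deriv_eq_of_eqOn_Ioi (G' := fun y => f y - 2 / y * w y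
      + (-7 * y ^ 4 + 6 * y ^ 2 - 3) / (y ^ 2 * (1 + y ^ 2) ^ 2) * v y
      + (12 * y ^ 6 - 44 * y ^ 4 + 20 * y ^ 2 + 12) / (y ^ 3 * (1 + y ^ 2) ^ 3) * q y
      + 24 * (y ^ 4 - 10 * y ^ 2 + 5) / (1 + y ^ 2) ^ 4 * u y) e3 fun y hy => by
    have hid := hasDerivAt_id y
    have c1 := (hid.const_mul 2).div ((hid.pow 2).const_add 1)
      (by simp only [id, Pi.pow_apply]; positivity)
    have c2 := ((((hid.pow 4).const_mul 3).sub ((hid.pow 2).const_mul 2)).add_const 3).div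
      ((hid.pow 2).mul (((hid.pow 2).const_add 1).pow 2))
      (by simp only [id, Pi.mul_apply, Pi.pow_apply]; positivity)
    have c := ((((hid.pow 4).sub ((hid.pow 2).const_mul 6)).add_const 1).const_mul 6).div
      (hid.mul (((hid.pow 2).const_add 1).pow 3))
      (by simp only [id, Pi.mul_apply, Pi.pow_apply]; positivity)
    refine ((((hw y hy).add (c1.mul (hv y hy))).sub (c2.mul (hq y hy))).sub
      (c.mul (hu y hy))).congr_deriv ?_
    simp only [id, Pi.mul_apply, Pi.pow_apply, Pi.div_apply, Pi.sub_apply, Zfun]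
    field_simp
    ring
  exact ⟨e1 y hy, e2 y hy, e3 y hy, e4 y hy⟩

/-- The pointwise energy density controlling all derivatives of `u` up to order four. -/
def energyDensity (u q v w f : ℝ → ℝ) (y : ℝ) : ℝ :=
  f y ^ 2 + w y ^ 2 / y ^ 2 + v y ^ 2 / y ^ 4 + q y ^ 2 / y ^ 6 + u y ^ 2 / (y ^ 4 * (1 + y ^ 4))

lemma sq_mul_div_le {c x p r K : ℝ} (hp : 0 < p) (hr : 0 < r) (h : c ^ 2 * r ≤ K * p) :
    (c * x) ^ 2 / p ≤ K * (x ^ 2 / r) := by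
  rw [mul_pow, mul_div_assoc', div_le_div_iff₀ hp hr]
  nlinarith [mul_le_mul_of_nonneg_left h (sq_nonneg x)]

lemma sq_sum_five_le (a b c d e : ℝ) :
    (a + b + c + d + e) ^ 2 ≤ 5 * (a ^ 2 + b ^ 2 + c ^ 2 + d ^ 2 + e ^ 2) := by
  nlinarith [sq_nonneg (a - b), sq_nonneg (a - c), sq_nonneg (a - d), sq_nonneg (a - e),
    sq_nonneg (b - c), sq_nonneg (b - d), sq_nonneg (b - e), sq_nonneg (c - d),
    sq_nonneg (c - e), sq_nonneg (d - e)]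

lemma sq_lin_comb_div_le {y p s a b c d e β γ δ ε : ℝ} {u q v w f : ℝ → ℝ} (hy : 0 < y)
    (hp : 0 < p) (hsp : s ^ 2 ≤ p) (ha : a ^ 2 ≤ p) (hb : b * y = s * β) (hc : c * y ^ 2 = s * γ)
    (hd : d * y ^ 3 = s * δ) (he : e * (y ^ 2 * (1 + y ^ 2)) = s * ε) (hβ : |β| ≤ 1000)
    (hγ : |γ| ≤ 1000) (hδ : |δ| ≤ 1000) (hε : |ε| ≤ 1000) :
    (a * f y + b * w y + c * v y + d * q y + e * u y) ^ 2 / p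
      ≤ 5000000 * energyDensity u q v w f y := by
  have key : ∀ x : ℝ, |x| ≤ 1000 → (s * x) ^ 2 ≤ 1000000 * p := fun x hx => by
    have hx2 : x ^ 2 ≤ 1000000 := by
      rw [← sq_abs]; nlinarith [abs_nonneg x]
    rw [mul_pow]
    nlinarith [mul_le_mul_of_nonneg_left hx2 (sq_nonneg s)]
  have h1 := sq_mul_div_le (x := f y) hp one_pos (by linarith : a ^ 2 * 1 ≤ 1000000 * p)
  have h2 := sq_mul_div_le (c := b) (x := w y) (r := y ^ 2) hp (by positivity) (K := 1000000)
    (by have := key β hβ; rw [← hb] at this; linarith)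
  have h3 := sq_mul_div_le (c := c) (x := v y) (r := y ^ 4) hp (by positivity) (K := 1000000)
    (by have := key γ hγ; rw [← hc] at this; linarith)
  have h4 := sq_mul_div_le (c := d) (x := q y) (r := y ^ 6) hp (by positivity) (K := 1000000)
    (by have := key δ hδ; rw [← hd] at this; linarith)
  have h5 := sq_mul_div_le (c := e) (x := u y) (r := y ^ 4 * (1 + y ^ 4)) hp (by positivity)
    (K := 1000000) (by
      have h := key ε hε
      rw [← he] at h
      have : 0 ≤ e ^ 2 * y ^ 4 * (2 * y ^ 2) := by positivity
      linarith)
  refine (div_le_div_of_nonneg_right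
    (sq_sum_five_le (a * f y) (b * w y) (c * v y) (d * q y) (e * u y)) hp.le).trans ?_
  rw [mul_div_assoc, add_div, add_div, add_div, add_div, energyDensity]
  rw [div_one] at h1
  linarith

lemma abs_div_le_of_nonneg {N D k : ℝ} (hD : 0 < D) (h1 : 0 ≤ k * D - N) (h2 : 0 ≤ k * D + N) :
    |N / D| ≤ k := by
  rw [abs_le, le_div_iff₀ hD, div_le_iff₀ hD]
  constructor <;> linarith

lemma derivatives_le_energyDensity {u q v w f : ℝ → ℝ}
    (hu : ∀ y, 0 < y → HasDerivAt u (-q y + Zfun y / y * u y) y)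
    (hq : ∀ y, 0 < y → HasDerivAt q (v y - 2 / (y * (1 + y ^ 2)) * q y) y)
    (hv : ∀ y, 0 < y → HasDerivAt v (-w y + Zfun y / y * v y) y)
    (hw : ∀ y, 0 < y → HasDerivAt w (f y - 2 / (y * (1 + y ^ 2)) * w y) y) {y : ℝ} (hy : 0 < y) :
    deriv v y ^ 2 / y ^ 2 ≤ 5000000 * energyDensity u q v w f y ∧
    deriv (deriv (deriv (deriv u))) y ^ 2 ≤ 5000000 * energyDensity u q v w f y ∧
    deriv (deriv (deriv u)) y ^ 2 / y ^ 2 ≤ 5000000 * energyDensity u q v w f y ∧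
    deriv (deriv u) y ^ 2 / y ^ 4 ≤ 5000000 * energyDensity u q v w f y ∧
    deriv u y ^ 2 / (y ^ 2 * (1 + y ^ 4)) ≤ 5000000 * energyDensity u q v w f y := by
  obtain ⟨e1, e2, e3, e4⟩ := iterated_deriv_expansion hu hq hv hw hy
  refine ⟨?_, ?_, ?_, ?_, ?_⟩
  · have h := sq_lin_comb_div_le (y := y) (p := y ^ 2) (s := y) (a := 0) (b := -1)
      (c := (1 - y ^ 2) / (y * (1 + y ^ 2))) (d := 0) (e := 0) (β := -1)
      (γ := (1 - y ^ 2) / (1 + y ^ 2)) (δ := 0) (ε := 0) (u := u) (q := q) (v := v) (w := w)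
      (f := f) hy (by positivity) le_rfl (by nlinarith) (by ring) (by field_simp) (by ring)
      (by ring) (by norm_num)
      (abs_div_le_of_nonneg (by positivity) (by ring_nf; positivity) (by ring_nf; positivity))
      (by norm_num) (by norm_num)
    convert h using 3
    rw [(hv y hy).deriv, Zfun]
    field_simp
    ring
  · have h := sq_lin_comb_div_le (y := y) (p := 1) (s := 1) (a := 1) (b := -(2 / y))
      (c := (-7 * y ^ 4 + 6 * y ^ 2 - 3) / (y ^ 2 * (1 + y ^ 2) ^ 2))
      (d := (12 * y ^ 6 - 44 * y ^ 4 + 20 * y ^ 2 + 12) / (y ^ 3 * (1 + y ^ 2) ^ 3))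
      (e := 24 * (y ^ 4 - 10 * y ^ 2 + 5) / (1 + y ^ 2) ^ 4) (β := -2)
      (γ := (-7 * y ^ 4 + 6 * y ^ 2 - 3) / (1 + y ^ 2) ^ 2)
      (δ := (12 * y ^ 6 - 44 * y ^ 4 + 20 * y ^ 2 + 12) / (1 + y ^ 2) ^ 3)
      (ε := 24 * (y ^ 4 - 10 * y ^ 2 + 5) * y ^ 2 / (1 + y ^ 2) ^ 3)
      (u := u) (q := q) (v := v) (w := w)
      (f := f) hy one_pos (by norm_num) (by norm_num) (by field_simp) (by field_simp)
      (by field_simp) (by field_simp) (by norm_num)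
      (abs_div_le_of_nonneg (by positivity) (by ring_nf; positivity) (by ring_nf; positivity))
      (abs_div_le_of_nonneg (by positivity) (by ring_nf; positivity) (by ring_nf; positivity))
      (abs_div_le_of_nonneg (by positivity) (by ring_nf; positivity) (by ring_nf; positivity))
    rw [div_one] at h
    convert h using 2
    rw [e4]
    ring
  · have h := sq_lin_comb_div_le (y := y) (p := y ^ 2) (s := y) (a := 0) (b := 1)
      (c := 2 * y / (1 + y ^ 2))
      (d := -(3 * y ^ 4 - 2 * y ^ 2 + 3) / (y ^ 2 * (1 + y ^ 2) ^ 2))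
      (e := -(6 * (y ^ 4 - 6 * y ^ 2 + 1)) / (y * (1 + y ^ 2) ^ 3)) (β := 1)
      (γ := 2 * y ^ 2 / (1 + y ^ 2))
      (δ := -(3 * y ^ 4 - 2 * y ^ 2 + 3) / (1 + y ^ 2) ^ 2)
      (ε := -(6 * (y ^ 4 - 6 * y ^ 2 + 1)) / (1 + y ^ 2) ^ 2)
      (u := u) (q := q) (v := v) (w := w)
      (f := f) hy (by positivity) le_rfl (by nlinarith) (by ring) (by field_simp)
      (by field_simp) (by field_simp) (by norm_num)
      (abs_div_le_of_nonneg (by positivity) (by ring_nf; positivity) (by ring_nf; positivity))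
      (abs_div_le_of_nonneg (by positivity) (by ring_nf; positivity) (by ring_nf; positivity))
      (abs_div_le_of_nonneg (by positivity) (by ring_nf; positivity) (by ring_nf; positivity))
    convert h using 3
    rw [e3]
    ring
  · have h := sq_lin_comb_div_le (y := y) (p := y ^ 4) (s := y ^ 2) (a := 0) (b := 0)
      (c := -1) (d := 1 / y)
      (e := 2 * (y ^ 2 - 3) / (1 + y ^ 2) ^ 2) (β := 0)
      (γ := -1) (δ := 1)
      (ε := 2 * (y ^ 2 - 3) / (1 + y ^ 2))
      (u := u) (q := q) (v := v) (w := w)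
      (f := f) hy (by positivity) (by ring_nf; exact le_rfl) (by ring_nf; positivity) (by ring)
      (by ring) (by field_simp) (by field_simp) (by norm_num) (by norm_num) (by norm_num)
      (abs_div_le_of_nonneg (by positivity) (by ring_nf; positivity) (by ring_nf; positivity))
    convert h using 3
    rw [e2]
    ring
  · have hs : (y * (1 + y ^ 2) / 2) ^ 2 ≤ y ^ 2 * (1 + y ^ 4) := by
      nlinarith [mul_nonneg (sq_nonneg y) (sq_nonneg (1 - y ^ 2)),
        mul_nonneg (sq_nonneg y) (sq_nonneg (1 + y ^ 2))]
    have h := sq_lin_comb_div_le (y := y) (p := y ^ 2 * (1 + y ^ 4)) (s := y * (1 + y ^ 2) / 2)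
      (a := 0) (b := 0) (c := 0) (d := -1)
      (e := (1 - y ^ 2) / (y * (1 + y ^ 2))) (β := 0)
      (γ := 0) (δ := -2 * y ^ 2 / (1 + y ^ 2))
      (ε := 2 * (1 - y ^ 2) / (1 + y ^ 2))
      (u := u) (q := q) (v := v) (w := w)
      (f := f) hy (by positivity) hs
      (by ring_nf; positivity) (by ring)
      (by ring) (by field_simp) (by field_simp) (by norm_num) (by norm_num)
      (abs_div_le_of_nonneg (by positivity) (by ring_nf; positivity) (by ring_nf; positivity))
      (abs_div_le_of_nonneg (by positivity) (by ring_nf; positivity) (by ring_nf; positivity))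
    convert h using 3
    rw [e1]
    ring

lemma mul_one_add_abs_log_le {y : ℝ} (hy : 0 < y) : y * (1 + |Real.log y|) ≤ 1 + y ^ 2 := by
  rcases le_total y 1 with h | h
  · exact (mul_one_add_abs_log_le_one hy h).trans (by nlinarith [sq_nonneg y])
  · rw [abs_of_nonneg (Real.log_nonneg h)]
    nlinarith [Real.log_le_sub_one_of_pos hy]

lemma pow_three_mul_sq_le {y R : ℝ} (hy : 0 < y) (hyR : y ≤ R) :
    y ^ 3 * (1 + |Real.log y|) ^ 2 ≤ R * (1 + R ^ 2) ^ 2 := by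
  have h1 : y * (1 + |Real.log y|) ≤ 1 + R ^ 2 :=
    (mul_one_add_abs_log_le hy).trans (by gcongr)
  have hR : 0 ≤ R := hy.le.trans hyR
  calc y ^ 3 * (1 + |Real.log y|) ^ 2 = y * (y * (1 + |Real.log y|)) ^ 2 := by ring
    _ ≤ R * (1 + R ^ 2) ^ 2 := by gcongr

/-- The weighted energy density whose integral is controlled by `∫ f² y dy`. -/
def weightedDensity (u q v w f : ℝ → ℝ) (y : ℝ) : ℝ :=
  f y ^ 2 * y + 4 * (w y ^ 2 / (y * (1 + Real.log (1 + y ^ 2)) ^ 2))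
    + v y ^ 2 * (1 / (y ^ 4 * (1 + |Real.log y|) ^ 2) * y)
    + q y ^ 2 * (1 / (y ^ 6 * (1 + |Real.log y|) ^ 2) * y)
    + u y ^ 2 * (1 / (y ^ 4 * (1 + y ^ 4) * (1 + |Real.log y|) ^ 2) * y)

lemma energyDensity_le_weightedDensity {u q v w f : ℝ → ℝ} {y : ℝ} (hy : 0 < y) :
    energyDensity u q v w f y * (y / (1 + |Real.log y|) ^ 2) ≤ weightedDensity u q v w f y := by
  have hL := one_le_one_add_abs_log y
  have hl := one_le_one_add_log_one_add_sq y
  have hlL := one_add_log_one_add_sq_le hy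
  have hL0 : 0 < 1 + |Real.log y| := by linarith
  have hl0 : 0 < 1 + Real.log (1 + y ^ 2) := by linarith
  have h1 : f y ^ 2 * (y / (1 + |Real.log y|) ^ 2) ≤ f y ^ 2 * y :=
    mul_le_mul_of_nonneg_left (div_le_self hy.le (one_le_pow₀ hL)) (sq_nonneg _)
  have h2 : w y ^ 2 / y ^ 2 * (y / (1 + |Real.log y|) ^ 2)
      ≤ 4 * (w y ^ 2 / (y * (1 + Real.log (1 + y ^ 2)) ^ 2)) := by
    have e : w y ^ 2 / y ^ 2 * (y / (1 + |Real.log y|) ^ 2)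
        = w y ^ 2 / (y * (1 + |Real.log y|) ^ 2) := by field_simp
    rw [e, mul_div_assoc', div_le_div_iff₀ (by positivity) (by positivity)]
    have : (1 + Real.log (1 + y ^ 2)) ^ 2 ≤ (2 * (1 + |Real.log y|)) ^ 2 := by gcongr
    have := mul_le_mul_of_nonneg_left this (by positivity : 0 ≤ w y ^ 2 * y)
    linarith
  have h3 : energyDensity u q v w f y * (y / (1 + |Real.log y|) ^ 2)
      = f y ^ 2 * (y / (1 + |Real.log y|) ^ 2) + w y ^ 2 / y ^ 2 * (y / (1 + |Real.log y|) ^ 2)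
      + v y ^ 2 * (1 / (y ^ 4 * (1 + |Real.log y|) ^ 2) * y)
      + q y ^ 2 * (1 / (y ^ 6 * (1 + |Real.log y|) ^ 2) * y)
      + u y ^ 2 * (1 / (y ^ 4 * (1 + y ^ 4) * (1 + |Real.log y|) ^ 2) * y) := by
    unfold energyDensity
    field_simp
  rw [h3, weightedDensity]
  linarith

lemma weighted_flux_sq_le {u q : ℝ → ℝ}
    (hu : ∀ y, 0 < y → HasDerivAt u (-q y + Zfun y / y * u y) y) {y : ℝ} (hy : 0 < y)
    (hy1 : y ≤ 1) :
    (q y * (y ^ 2 / (1 + y ^ 2))) ^ 2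
      ≤ 4 * (deriv u y ^ 2 / (y ^ 2 * (1 + y ^ 4) * (1 + |Real.log y|) ^ 2) * y
        + u y ^ 2 / (y ^ 4 * (1 + y ^ 4) * (1 + |Real.log y|) ^ 2) * y) * y := by
  have hL := one_le_one_add_abs_log y
  set L := 1 + |Real.log y| with hLdef
  have hyL : y * L ≤ 1 := mul_one_add_abs_log_le_one hy hy1
  have hL0 : 0 < L := by linarith
  have hq : q y = -deriv u y + Zfun y / y * u y := by rw [(hu y hy).deriv]; ring
  have hq2 : q y * (y ^ 2 / (1 + y ^ 2))
      = -(deriv u y * y ^ 2 / (1 + y ^ 2)) + (1 - y ^ 2) / (1 + y ^ 2) * (u y * y / (1 + y ^ 2)) := by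
    rw [hq, Zfun]; field_simp
  have hy2 : y ^ 2 ≤ 1 := pow_le_one₀ hy.le hy1
  have hy4 : y ^ 4 ≤ 1 := pow_le_one₀ hy.le hy1
  have hyL2 : y ^ 2 * L ^ 2 ≤ 1 := by
    rw [← mul_pow]; exact pow_le_one₀ (by positivity) hyL
  have hz1 : |(1 - y ^ 2) / (1 + y ^ 2)| ≤ 1 :=
    abs_div_le_of_nonneg (by positivity) (by ring_nf; positivity) (by ring_nf; norm_num)
  have hz : ((1 - y ^ 2) / (1 + y ^ 2)) ^ 2 ≤ 1 := by
    rw [← sq_abs]; exact pow_le_one₀ (abs_nonneg _) hz1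
  have hden : 1 ≤ (1 + y ^ 2) ^ 2 := one_le_pow₀ (by nlinarith)
  have a1 : (deriv u y * y ^ 2 / (1 + y ^ 2)) ^ 2
      ≤ 2 * (deriv u y ^ 2 / (y ^ 2 * (1 + y ^ 4) * L ^ 2) * y) * y := by
    have e : 2 * (deriv u y ^ 2 / (y ^ 2 * (1 + y ^ 4) * L ^ 2) * y) * y
        = 2 * deriv u y ^ 2 / ((1 + y ^ 4) * L ^ 2) := by field_simp
    rw [e, div_pow, div_le_div_iff₀ (by positivity) (by positivity)]
    have k1 : y ^ 4 * ((1 + y ^ 4) * L ^ 2) ≤ 2 * (1 + y ^ 2) ^ 2 := by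
      have : y ^ 4 * ((1 + y ^ 4) * L ^ 2) = (y ^ 2 * L ^ 2) * (y ^ 2 * (1 + y ^ 4)) := by ring
      rw [this]
      have k2 : y ^ 2 * (1 + y ^ 4) ≤ 1 * 2 := by gcongr; linarith
      have k3 := mul_le_mul hyL2 k2 (by positivity) zero_le_one
      linarith
    have := mul_le_mul_of_nonneg_left k1 (sq_nonneg (deriv u y))
    linarith
  have a2 : (u y * y / (1 + y ^ 2)) ^ 2
      ≤ 2 * (u y ^ 2 / (y ^ 4 * (1 + y ^ 4) * L ^ 2) * y) * y := by
    have e : 2 * (u y ^ 2 / (y ^ 4 * (1 + y ^ 4) * L ^ 2) * y) * y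
        = 2 * u y ^ 2 / (y ^ 2 * (1 + y ^ 4) * L ^ 2) := by field_simp
    rw [e, div_pow, div_le_div_iff₀ (by positivity) (by positivity)]
    have k1 : y ^ 2 * (y ^ 2 * (1 + y ^ 4) * L ^ 2) ≤ 2 * (1 + y ^ 2) ^ 2 := by
      have : y ^ 2 * (y ^ 2 * (1 + y ^ 4) * L ^ 2) = (y ^ 2 * L ^ 2) * (y ^ 2 * (1 + y ^ 4)) := by
        ring
      rw [this]
      have k2 : y ^ 2 * (1 + y ^ 4) ≤ 1 * 2 := by gcongr; linarith
      have k3 := mul_le_mul hyL2 k2 (by positivity) zero_le_one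
      linarith
    have := mul_le_mul_of_nonneg_left k1 (sq_nonneg (u y))
    linarith
  have a3 := mul_le_mul_of_nonneg_right hz (sq_nonneg (u y * y / (1 + y ^ 2)))
  rw [← mul_pow] at a3
  rw [hq2]
  nlinarith [sq_nonneg (deriv u y * y ^ 2 / (1 + y ^ 2)
    + (1 - y ^ 2) / (1 + y ^ 2) * (u y * y / (1 + y ^ 2)))]

/-- The chain of Hardy-type inequalities along `u, q, v, w, f`. -/
lemma weightedDensity_integral_le {Φ : ℝ → ℝ} {B R : ℝ} (hΦc : ContinuousOn Φ (Ioi 0))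
    (hB : 0 ≤ B) (hΦb : ∀ y, 0 < y → |Φ y| ≤ B * y) (hΦ0 : ∀ y, R ≤ y → Φ y = 0)
    (hD : 0 < ip Lphi Φ) :
    ∃ C : ℝ, 0 < C ∧ ∀ u q v w f : ℝ → ℝ,
      (∀ y, 0 < y → HasDerivAt u (-q y + Zfun y / y * u y) y) →
      (∀ y, 0 < y → HasDerivAt q (v y - 2 / (y * (1 + y ^ 2)) * q y) y) →
      (∀ y, 0 < y → HasDerivAt v (-w y + Zfun y / y * v y) y) →
      (∀ y, 0 < y → HasDerivAt w (f y - 2 / (y * (1 + y ^ 2)) * w y) y) →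
      IntegrableOn (fun y => f y ^ 2 * y) (Ioi 0) →
      IntegrableOn (fun y => w y ^ 2 / (y ^ 2 * (1 + y ^ 2)) * y) (Ioi 0) →
      IntegrableOn (fun y => u y ^ 2 / (y ^ 4 * (1 + y ^ 4) * (1 + |Real.log y|) ^ 2) * y)
        (Ioi 0) →
      IntegrableOn
        (fun y => deriv u y ^ 2 / (y ^ 2 * (1 + y ^ 4) * (1 + |Real.log y|) ^ 2) * y) (Ioi 0) →
      ip u Φ = 0 → ip v Φ = 0 →
      IntegrableOn (weightedDensity u q v w f) (Ioi 0) ∧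
        ∫ y in Ioi (0:ℝ), weightedDensity u q v w f y
          ≤ C * ∫ y in Ioi (0:ℝ), f y ^ 2 * y := by
  have hL0 : ∀ y : ℝ, 0 < 1 + |Real.log y| := fun y =>
    lt_of_lt_of_le one_pos (one_le_one_add_abs_log y)
  obtain ⟨C₁, hC₁, H₁⟩ := coercive_Aop 0 (Φ := Φ)
    (wt := fun y => 1 / (y ^ 4 * (1 + |Real.log y|) ^ 2) * y) (K₀ := R * (1 + R ^ 2) ^ 2)
    hΦc hB hΦb hΦ0 hD
    ((continuousOn_const.div ((continuousOn_id.pow 4).mul (continuousOn_one_add_abs_log.pow 2))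
      fun y hy => (mul_pos (pow_pos hy 4) (pow_pos (hL0 y) 2)).ne').mul continuousOn_id)
    (fun y hy => by have := hL0 y; positivity)
    (fun y hy _ => by have := hL0 y; apply le_of_eq; field_simp)
    (fun y hy => by have := hL0 y; have : 0 < y := by linarith
                    apply le_of_eq; field_simp)
    (fun y hy hyR => by
      have := hL0 y
      have e : R * (1 + R ^ 2) ^ 2 * (1 / (y ^ 4 * (1 + |Real.log y|) ^ 2) * y)
          = R * (1 + R ^ 2) ^ 2 / (y ^ 3 * (1 + |Real.log y|) ^ 2) := by field_simp
      rw [e, one_le_div (by positivity)]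
      exact pow_three_mul_sq_le hy hyR)
  obtain ⟨C₂, hC₂, H₂⟩ := coercive_Aop 4 (Φ := Φ)
    (wt := fun y => 1 / (y ^ 4 * (1 + y ^ 4) * (1 + |Real.log y|) ^ 2) * y)
    (K₀ := R * (1 + R ^ 2) ^ 2 * (1 + R ^ 4))
    hΦc hB hΦb hΦ0 hD
    ((continuousOn_const.div (((continuousOn_id.pow 4).mul
        (continuousOn_const.add (continuousOn_id.pow 4))).mul (continuousOn_one_add_abs_log.pow 2))
      fun y hy => (mul_pos (mul_pos (pow_pos hy 4) (add_pos one_pos (pow_pos hy 4)))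
        (pow_pos (hL0 y) 2)).ne').mul continuousOn_id)
    (fun y hy => by have := hL0 y; positivity)
    (fun y hy _ => by
      have := hL0 y
      have e : 1 / (y ^ 4 * (1 + y ^ 4) * (1 + |Real.log y|) ^ 2) * y
          * (y ^ 3 * (1 + |Real.log y|) ^ 2) = 1 / (1 + y ^ 4) := by field_simp
      rw [e, div_le_one (by positivity)]
      linarith [pow_pos hy 4])
    (fun y hy => by
      have := hL0 y
      have hy0 : 0 < y := by linarith
      have e : 1 / (y ^ 4 * (1 + y ^ 4) * (1 + |Real.log y|) ^ 2) * y
          * (y ^ (4 + 3) * (1 + |Real.log y|) ^ 2) = y ^ 4 / (1 + y ^ 4) := by field_simp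
      rw [e, div_le_one (by positivity)]
      linarith)
    (fun y hy hyR => by
      have := hL0 y
      have hR : 0 ≤ R := hy.le.trans hyR
      have e : R * (1 + R ^ 2) ^ 2 * (1 + R ^ 4)
            * (1 / (y ^ 4 * (1 + y ^ 4) * (1 + |Real.log y|) ^ 2) * y)
          = R * (1 + R ^ 2) ^ 2 * (1 + R ^ 4) / (y ^ 3 * (1 + |Real.log y|) ^ 2 * (1 + y ^ 4)) := by
        field_simp
      rw [e, one_le_div (by positivity)]
      have := pow_three_mul_sq_le hy hyR
      gcongr)
  refine ⟨1 + 32 + C₁ * 128 + 8 * (C₁ * 128) + C₂ * (32 * (C₁ * 128)), by positivity,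
    fun u q v w f hu hq hv hw hf hwI huI huI' hort hort' => ?_⟩
  obtain ⟨hW, hWle⟩ := hardy_adjoint_L2 hw hwI hf
  obtain ⟨hV, hVle⟩ := H₁ v w
    (fun y => 16 * (w y ^ 2 / (y * (1 + Real.log (1 + y ^ 2)) ^ 2))) hv (hW.const_mul 16)
    (fun y hy => by positivity)
    (fun y hy hy1 => by
      have hl := one_le_one_add_log_one_add_sq y
      have hl2 : 1 + Real.log (1 + y ^ 2) ≤ 2 := by
        have := Real.log_le_sub_one_of_pos (by positivity : 0 < 1 + y ^ 2)
        nlinarith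
      have hl0 : 0 < 1 + Real.log (1 + y ^ 2) := by linarith
      have e : 16 * (w y ^ 2 / (y * (1 + Real.log (1 + y ^ 2)) ^ 2)) * y
          = 16 * w y ^ 2 / (1 + Real.log (1 + y ^ 2)) ^ 2 := by field_simp
      rw [e, le_div_iff₀ (by positivity)]
      have : (1 + Real.log (1 + y ^ 2)) ^ 2 ≤ 2 ^ 2 := by gcongr
      have := mul_le_mul_of_nonneg_left this (sq_nonneg (w y))
      linarith)
    (fun y hy => by
      have hy0 : 0 < y := by linarith
      have hl := one_le_one_add_log_one_add_sq y
      have hl0 : 0 < 1 + Real.log (1 + y ^ 2) := by linarith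
      have hlL := one_add_log_one_add_sq_le hy0
      have e : 16 * (w y ^ 2 / (y * (1 + Real.log (1 + y ^ 2)) ^ 2))
            * (y ^ (0 + 1) * (1 + |Real.log y|) ^ 2)
          = 16 * w y ^ 2 * (1 + |Real.log y|) ^ 2 / (1 + Real.log (1 + y ^ 2)) ^ 2 := by
        rw [zero_add, pow_one]
        field_simp
      rw [e, le_div_iff₀ (by positivity)]
      have : (1 + Real.log (1 + y ^ 2)) ^ 2 ≤ (2 * (1 + |Real.log y|)) ^ 2 := by gcongr
      have := mul_le_mul_of_nonneg_left this (sq_nonneg (w y))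
      linarith)
    hort'
  obtain ⟨hQ, hQle⟩ := hardy_adjoint_log hq
    (fun δ a hδ ha => exists_sq_lt_of_integrableOn
      (g := fun y => q y * (y ^ 2 / (1 + y ^ 2))) ((huI'.add huI).const_mul 4)
      (fun y hy hy1 => weighted_flux_sq_le hu hy hy1) hδ ha) hV
  obtain ⟨hU, hUle⟩ := H₂ u q
    (fun y => 4 * (q y ^ 2 * (1 / (y ^ 6 * (1 + |Real.log y|) ^ 2) * y))) hu (hQ.const_mul 4)
    (fun y hy => by have := hL0 y; positivity)
    (fun y hy hy1 => by
      have h0 := hL0 y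
      have e : 4 * (q y ^ 2 * (1 / (y ^ 6 * (1 + |Real.log y|) ^ 2) * y)) * y
          = 4 * q y ^ 2 / (y ^ 2 * (y * (1 + |Real.log y|)) ^ 2) := by field_simp
      rw [e, le_div_iff₀ (by positivity)]
      have h1 : (y * (1 + |Real.log y|)) ^ 2 ≤ 1 :=
        pow_le_one₀ (by positivity) (mul_one_add_abs_log_le_one hy hy1)
      have h2 : y ^ 2 ≤ 1 := pow_le_one₀ hy.le hy1
      exact mul_le_of_le_one_right (by positivity) (mul_le_one₀ h2 (by positivity) h1))
    (fun y hy => by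
      have h0 := hL0 y
      have hy0 : 0 < y := by linarith
      apply le_of_eq
      field_simp)
    hort
  refine ⟨(((hf.add (hW.const_mul 4)).add hV).add hQ).add hU, ?_⟩
  have hsum : ∫ y in Ioi (0:ℝ), weightedDensity u q v w f y
      = (∫ y in Ioi (0:ℝ), f y ^ 2 * y)
        + 4 * (∫ y in Ioi (0:ℝ), w y ^ 2 / (y * (1 + Real.log (1 + y ^ 2)) ^ 2))
        + (∫ y in Ioi (0:ℝ), v y ^ 2 * (1 / (y ^ 4 * (1 + |Real.log y|) ^ 2) * y))
        + (∫ y in Ioi (0:ℝ), q y ^ 2 * (1 / (y ^ 6 * (1 + |Real.log y|) ^ 2) * y))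
        + ∫ y in Ioi (0:ℝ),
            u y ^ 2 * (1 / (y ^ 4 * (1 + y ^ 4) * (1 + |Real.log y|) ^ 2) * y) := by
    have s1 := integral_add hf (hW.const_mul 4)
    have s2 := integral_add (hf.add (hW.const_mul 4)) hV
    have s3 := integral_add ((hf.add (hW.const_mul 4)).add hV) hQ
    have s4 := integral_add (((hf.add (hW.const_mul 4)).add hV).add hQ) hU
    simp only [Pi.add_apply] at s2 s3 s4
    simp only [weightedDensity]
    rw [s4, s3, s2, s1, integral_const_mul]
  rw [integral_const_mul] at hVle hUle
  rw [hsum]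
  have b1 := mul_le_mul_of_nonneg_left hWle (by positivity : 0 ≤ C₁ * 16)
  have b2 : ∫ y in Ioi (0:ℝ), v y ^ 2 * (1 / (y ^ 4 * (1 + |Real.log y|) ^ 2) * y)
      ≤ C₁ * 128 * ∫ y in Ioi (0:ℝ), f y ^ 2 * y := by linarith
  have b3 := mul_le_mul_of_nonneg_left (hQle.trans (mul_le_mul_of_nonneg_left b2 (by norm_num)))
    (by positivity : 0 ≤ C₂ * 4)
  linarith

lemma setIntegral_Ioi_le_of_le_mul {g G : ℝ → ℝ} {K : ℝ} (hG : IntegrableOn G (Ioi 0))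
    (h0 : ∀ y, 0 < y → 0 ≤ g y) (h : ∀ y, 0 < y → g y ≤ K * G y) :
    ∫ y in Ioi (0:ℝ), g y ≤ K * ∫ y in Ioi (0:ℝ), G y := by
  rw [← integral_const_mul]
  exact integral_mono_of_nonneg
    ((ae_restrict_iff' measurableSet_Ioi).2 (Filter.Eventually.of_forall h0)) (hG.const_mul K)
    ((ae_restrict_iff' measurableSet_Ioi).2 (Filter.Eventually.of_forall h))

lemma integrableOn_sq_of_adjoint {w f : ℝ → ℝ} (hfc : ContinuousOn f (Ioi 0))
    (hw : ∀ y, 0 < y → HasDerivAt w (f y - 2 / (y * (1 + y ^ 2)) * w y) y)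
    (hw' : IntegrableOn (fun y => deriv w y ^ 2 * y) (Ioi 0))
    (hwI : IntegrableOn (fun y => w y ^ 2 / (y ^ 2 * (1 + y ^ 2)) * y) (Ioi 0)) :
    IntegrableOn (fun y => f y ^ 2 * y) (Ioi 0) := by
  refine Integrable.mono' ((hw'.const_mul 2).add (hwI.const_mul 8))
    (((hfc.pow 2).mul continuousOn_id).aestronglyMeasurable measurableSet_Ioi) ?_
  refine (ae_restrict_iff' measurableSet_Ioi).2 (Filter.Eventually.of_forall fun y hy => ?_)
  have hy0 : 0 < y := hy
  rw [Real.norm_eq_abs, abs_of_nonneg (by positivity), Pi.add_apply]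
  have hf : f y = deriv w y + 2 / (y * (1 + y ^ 2)) * w y := by rw [(hw y hy).deriv]; ring
  have h1 : (2 / (y * (1 + y ^ 2)) * w y) ^ 2 ≤ 4 * (w y ^ 2 / (y ^ 2 * (1 + y ^ 2))) := by
    rw [mul_pow, div_pow, mul_div_assoc', div_mul_eq_mul_div,
      div_le_div_iff₀ (by positivity) (by positivity)]
    have : 0 ≤ 4 * w y ^ 2 * (y ^ 2 * (1 + y ^ 2)) * y ^ 2 := by positivity
    linarith
  have h2 : f y ^ 2 ≤ 2 * deriv w y ^ 2 + 8 * (w y ^ 2 / (y ^ 2 * (1 + y ^ 2))) := by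
    rw [hf]
    nlinarith [sq_nonneg (deriv w y - 2 / (y * (1 + y ^ 2)) * w y)]
  have := mul_le_mul_of_nonneg_right h2 hy0.le
  linarith

/-- Coercivity of `H²` under the orthogonality conditions `(u,Φ_M) = (Hu,Φ_M) = 0`. -/
theorem coercivity_H_squared (χ : ℝ → ℝ) (hχ : ContDiff ℝ (⊤ : ℕ∞) χ)
    (hχ1 : ∀ y : ℝ, y ≤ 1 → χ y = 1) (hχ0 : ∀ y : ℝ, 2 ≤ y → χ y = 0)
    (hχr : ∀ y : ℝ, 0 ≤ χ y ∧ χ y ≤ 1) :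
    ∃ M₀ : ℝ, 1 ≤ M₀ ∧
      ∀ M : ℝ, M₀ ≤ M →
        ip (Hop (cutLphi χ M)) T1 ≠ 0 ∧
        ∃ C : ℝ, 0 < C ∧
          ∀ u : ℝ → ℝ, ContDiffOn ℝ 4 u (Set.Ioi 0) →
            IntegrableOn (fun y => (deriv (Aop (Hop u)) y) ^ 2 * y) (Set.Ioi 0) →
            IntegrableOn (fun y => (Aop (Hop u) y) ^ 2 / (y ^ 2 * (1 + y ^ 2)) * y)
              (Set.Ioi 0) →
            IntegrableOn
              (fun y => (Hop u y) ^ 2 / (y ^ 4 * (1 + |Real.log y|) ^ 2) * y)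
              (Set.Ioi 0) →
            IntegrableOn
              (fun y => (u y) ^ 2 / (y ^ 4 * (1 + y ^ 4) * (1 + |Real.log y|) ^ 2) * y)
              (Set.Ioi 0) →
            IntegrableOn
              (fun y =>
                (deriv u y) ^ 2 / (y ^ 2 * (1 + y ^ 4) * (1 + |Real.log y|) ^ 2) * y)
              (Set.Ioi 0) →
            ip u (PhiM χ M) = 0 →
            ip (Hop u) (PhiM χ M) = 0 →
            (∫ y in Set.Ioi (0:ℝ),
                  (Hop u y) ^ 2 / (y ^ 4 * (1 + |Real.log y|) ^ 2) * y)
                + (∫ y in Set.Ioi (0:ℝ),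
                  (deriv (Hop u) y) ^ 2 / (y ^ 2 * (1 + |Real.log y|) ^ 2) * y)
                + (∫ y in Set.Ioi (0:ℝ),
                  (deriv (deriv (deriv (deriv u))) y) ^ 2 / (1 + |Real.log y|) ^ 2 * y)
                + (∫ y in Set.Ioi (0:ℝ),
                  (deriv (deriv (deriv u)) y) ^ 2 / (y ^ 2 * (1 + |Real.log y|) ^ 2) * y)
                + (∫ y in Set.Ioi (0:ℝ),
                  (deriv (deriv u) y) ^ 2 / (y ^ 4 * (1 + |Real.log y|) ^ 2) * y)
                + (∫ y in Set.Ioi (0:ℝ),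
                  (deriv u y) ^ 2 / (y ^ 2 * (1 + y ^ 4) * (1 + |Real.log y|) ^ 2) * y)
                + (∫ y in Set.Ioi (0:ℝ),
                  (u y) ^ 2 / (y ^ 4 * (1 + y ^ 4) * (1 + |Real.log y|) ^ 2) * y)
              ≤ C * ∫ y in Set.Ioi (0:ℝ), (Hop (Hop u) y) ^ 2 * y := by
  refine ⟨1, le_rfl, fun M hM => ?_⟩
  have hcut : IsCutoffAt (fun y => χ (y / M)) M :=
    isCutoffAt_comp_div hχ hχ1 hχ0 hχr (by linarith)
  refine ⟨hcut.ip_Hop_T1_neg.ne, ?_⟩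
  obtain ⟨B, hB, hΦb⟩ := hcut.exists_abs_profile_le (cMconst χ M)
  obtain ⟨C, hC, H⟩ := weightedDensity_integral_le (Φ := PhiM χ M)
    (hcut.continuousOn_profile _) hB hΦb (fun y hy => hcut.profile_eq_zero _ hy)
    (hcut.ip_Lphi_pos _)
  refine ⟨7 * (5000000 * C), by positivity,
    fun u hu hw' hwI _ huI huI' hort hort' => ?_⟩
  have hv2 : ContDiffOn ℝ 2 (Hop u) (Ioi 0) := contDiffOn_Hop (n := 2) hu
  have hu2 : ContDiffOn ℝ 2 u (Ioi 0) := hu.of_le (by norm_num)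
  have dU : ∀ y, 0 < y → HasDerivAt u (-Aop u y + Zfun y / y * u y) y := fun y hy =>
    hasDerivAt_of_Aop (differentiableAt_deriv_of_contDiffOn hu2 hy).1
  have dQ : ∀ y, 0 < y → HasDerivAt (Aop u) (Hop u y - 2 / (y * (1 + y ^ 2)) * Aop u y) y :=
    fun y hy => hasDerivAt_Aop hy (differentiableAt_deriv_of_contDiffOn hu2 hy).1
      (differentiableAt_deriv_of_contDiffOn hu2 hy).2
  have dV : ∀ y, 0 < y → HasDerivAt (Hop u) (-Aop (Hop u) y + Zfun y / y * Hop u y) y :=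
    fun y hy => hasDerivAt_of_Aop (differentiableAt_deriv_of_contDiffOn hv2 hy).1
  have dW : ∀ y, 0 < y → HasDerivAt (Aop (Hop u))
      (Hop (Hop u) y - 2 / (y * (1 + y ^ 2)) * Aop (Hop u) y) y :=
    fun y hy => hasDerivAt_Aop hy (differentiableAt_deriv_of_contDiffOn hv2 hy).1
      (differentiableAt_deriv_of_contDiffOn hv2 hy).2
  have hf : IntegrableOn (fun y => Hop (Hop u) y ^ 2 * y) (Ioi 0) :=
    integrableOn_sq_of_adjoint (contDiffOn_Hop (n := 0) hv2).continuousOn dW hw' hwI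
  obtain ⟨hGI, hG⟩ := H u (Aop u) (Hop u) (Aop (Hop u)) (Hop (Hop u)) dU dQ dV dW hf hwI huI huI'
    hort hort'
  have key : ∀ g d : ℝ → ℝ, (∀ y, 0 < y → 0 ≤ d y) →
      (∀ y, 0 < y → d y
        ≤ 5000000 * energyDensity u (Aop u) (Hop u) (Aop (Hop u)) (Hop (Hop u)) y) →
      (∀ y, 0 < y → g y = d y * (y / (1 + |Real.log y|) ^ 2)) →
      ∫ y in Ioi (0:ℝ), g y ≤ 5000000 * C * ∫ y in Ioi (0:ℝ), Hop (Hop u) y ^ 2 * y := by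
    intro g d hd hdE hg
    have hL : ∀ y : ℝ, 0 < y → 0 ≤ y / (1 + |Real.log y|) ^ 2 := fun y hy => by positivity
    refine (setIntegral_Ioi_le_of_le_mul hGI (K := 5000000)
      (fun y hy => by rw [hg y hy]; exact mul_nonneg (hd y hy) (hL y hy)) fun y hy => ?_).trans ?_
    · rw [hg y hy]
      refine (mul_le_mul_of_nonneg_right (hdE y hy) (hL y hy)).trans ?_
      rw [mul_assoc]
      exact mul_le_mul_of_nonneg_left (energyDensity_le_weightedDensity hy) (by norm_num)
    · rw [mul_assoc]
      exact mul_le_mul_of_nonneg_left hG (by norm_num)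
  have hE := fun y (hy : 0 < y) => derivatives_le_energyDensity dU dQ dV dW hy
  have halg : ∀ a b c d : ℝ, a / (b * c) * d = a / b * (d / c) := fun a b c d => by
    rw [div_mul_div_comm, div_mul_eq_mul_div]
  have t1 := key (fun y => Hop u y ^ 2 / (y ^ 4 * (1 + |Real.log y|) ^ 2) * y)
    (fun y => Hop u y ^ 2 / y ^ 4) (fun y hy => by positivity)
    (fun y hy => by
      unfold energyDensity
      have h1 : 0 ≤ Hop (Hop u) y ^ 2 := sq_nonneg _
      have h2 : 0 ≤ Aop (Hop u) y ^ 2 / y ^ 2 := by positivity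
      have h3 : 0 ≤ Hop u y ^ 2 / y ^ 4 := by positivity
      have h4 : 0 ≤ Aop u y ^ 2 / y ^ 6 := by positivity
      have h5 : 0 ≤ u y ^ 2 / (y ^ 4 * (1 + y ^ 4)) := by positivity
      linarith)
    (fun y _ => halg _ _ _ _)
  have t2 := key (fun y => deriv (Hop u) y ^ 2 / (y ^ 2 * (1 + |Real.log y|) ^ 2) * y)
    (fun y => deriv (Hop u) y ^ 2 / y ^ 2) (fun y hy => by positivity)
    (fun y hy => (hE y hy).1) (fun y _ => halg _ _ _ _)
  have t3 := key (fun y => deriv (deriv (deriv (deriv u))) y ^ 2 / (1 + |Real.log y|) ^ 2 * y)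
    (fun y => deriv (deriv (deriv (deriv u))) y ^ 2) (fun y hy => by positivity)
    (fun y hy => (hE y hy).2.1) (fun y _ => by ring)
  have t4 := key
    (fun y => deriv (deriv (deriv u)) y ^ 2 / (y ^ 2 * (1 + |Real.log y|) ^ 2) * y)
    (fun y => deriv (deriv (deriv u)) y ^ 2 / y ^ 2) (fun y hy => by positivity)
    (fun y hy => (hE y hy).2.2.1) (fun y _ => halg _ _ _ _)
  have t5 := key (fun y => deriv (deriv u) y ^ 2 / (y ^ 4 * (1 + |Real.log y|) ^ 2) * y)
    (fun y => deriv (deriv u) y ^ 2 / y ^ 4) (fun y hy => by positivity)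
    (fun y hy => (hE y hy).2.2.2.1) (fun y _ => halg _ _ _ _)
  have t6 := key
    (fun y => deriv u y ^ 2 / (y ^ 2 * (1 + y ^ 4) * (1 + |Real.log y|) ^ 2) * y)
    (fun y => deriv u y ^ 2 / (y ^ 2 * (1 + y ^ 4))) (fun y hy => by positivity)
    (fun y hy => (hE y hy).2.2.2.2) (fun y _ => halg _ _ _ _)
  have t7 := key
    (fun y => u y ^ 2 / (y ^ 4 * (1 + y ^ 4) * (1 + |Real.log y|) ^ 2) * y)
    (fun y => u y ^ 2 / (y ^ 4 * (1 + y ^ 4))) (fun y hy => by positivity)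
    (fun y hy => by
      unfold energyDensity
      have h1 : 0 ≤ Hop (Hop u) y ^ 2 := sq_nonneg _
      have h2 : 0 ≤ Aop (Hop u) y ^ 2 / y ^ 2 := by positivity
      have h3 : 0 ≤ Hop u y ^ 2 / y ^ 4 := by positivity
      have h4 : 0 ≤ Aop u y ^ 2 / y ^ 6 := by positivity
      have h5 : 0 ≤ u y ^ 2 / (y ^ 4 * (1 + y ^ 4)) := by positivity
      linarith)
    (fun y _ => halg _ _ _ _)
  linarith
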